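/- Let a, b > 0 with a − 2b > 0, η ∈ (0, √(a−b) − √(a/2)), φ_η an admissible cutoff, and k ∈ ℕ. If A_k is non-empty, then sup A_k ∈ I_{k−1} ∪ I_k (with I_{−1} = ∅ when k = 0). -/

import Mathlib

open Real Set Filter Topology

noncomputable section

/-- The Hamiltonian energy `H(f,g) = ½ f²(1−g²) + (a/4) g⁴ − (b/2) g²`. -/
def Ham (a b f g : ℝ) : ℝ := 1 / 2 * f ^ 2 * (1 - g ^ 2) + a / 4 * g ^ 4 - b / 2 * g ^ 2

/-- The set `𝒜` of admissible points. -/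
def Aadm (a b : ℝ) : Set (ℝ × ℝ) :=
  {p | 2 * p.1 ^ 2 - a * p.2 ^ 2 - (a - 2 * b) ≤ 0 ∧ p.2 ^ 2 ≤ 1}

/-- `φ` is an admissible cutoff function `φ_η`. -/
def IsCutoff (a b η : ℝ) (φ : ℝ → ℝ → ℝ) : Prop :=
  (∀ f g, φ f g ∈ Icc (0 : ℝ) 1) ∧
  ContDiffOn ℝ (⊤ : ℕ∞) (fun p : ℝ × ℝ => φ p.1 p.2)
    (Ioo (-Real.sqrt (a - b)) (Real.sqrt (a - b)) ×ˢ (univ : Set ℝ)) ∧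
  (∀ f g, φ f g = φ |f| |g|) ∧
  (∀ f g, Real.sqrt (a - b) - η / 2 ≤ |f| → φ f g = 0) ∧
  (∀ f g, |f| ≤ Real.sqrt (a - b) - η → φ f g = 1)

/-- `(f, g)` is a `C¹` solution on `s` of the original Cauchy problem
`f' + (2/r) f = g(f² − a g² + b)`, `g' = f(1 − g²)`, `f(0) = 0`, `g(0) = x`. -/
def IsSolOn (a b x : ℝ) (f g : ℝ → ℝ) (s : Set ℝ) : Prop :=
  f 0 = 0 ∧ g 0 = x ∧ ContinuousOn f s ∧ ContinuousOn g s ∧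
  ∀ r ∈ s, 0 < r →
    HasDerivAt f (g r * ((f r) ^ 2 - a * (g r) ^ 2 + b) - 2 / r * f r) r ∧
    HasDerivAt g (f r * (1 - (g r) ^ 2)) r

/-- `(f, g)` is a `C¹` solution on `s` of the regularized Cauchy problem
`f' + (2 φ(f,g)/r) f = g(f² − a g² + b)`, `g' = f(1 − g²)`, `f(0) = 0`, `g(0) = x`. -/
def IsRegSolOn (a b : ℝ) (φ : ℝ → ℝ → ℝ) (x : ℝ) (f g : ℝ → ℝ) (s : Set ℝ) : Prop :=
  f 0 = 0 ∧ g 0 = x ∧ ContinuousOn f s ∧ ContinuousOn g s ∧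
  ∀ r ∈ s, 0 < r →
    HasDerivAt f (g r * ((f r) ^ 2 - a * (g r) ^ 2 + b) - 2 * φ (f r) (g r) / r * f r) r ∧
    HasDerivAt g (f r * (1 - (g r) ^ 2)) r

/-- `(f, g)` is a solution on `s` of the autonomous (Hamiltonian) system
`f' = g(f² − a g² + b)`, `g' = f(1 − g²)` with initial data `(fi, gi)`. -/
def IsAutSolOn (a b fi gi : ℝ) (f g : ℝ → ℝ) (s : Set ℝ) : Prop :=
  f 0 = fi ∧ g 0 = gi ∧ ContinuousOn f s ∧ ContinuousOn g s ∧
  ∀ r ∈ s,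
    HasDerivAt f (g r * ((f r) ^ 2 - a * (g r) ^ 2 + b)) r ∧
    HasDerivAt g (f r * (1 - (g r) ^ 2)) r

/-- `(f, g)` is a solution on `s` of the shifted regularized system
`f' + (2 φ(f,g)/(ρ+r)) f = g(f² − a g² + b)`, `g' = f(1 − g²)` with initial data `(fi, gi)`. -/
def IsShiftSolOn (a b : ℝ) (φ : ℝ → ℝ → ℝ) (ρ fi gi : ℝ) (f g : ℝ → ℝ) (s : Set ℝ) : Prop :=
  f 0 = fi ∧ g 0 = gi ∧ ContinuousOn f s ∧ ContinuousOn g s ∧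
  ∀ r ∈ s,
    HasDerivAt f (g r * ((f r) ^ 2 - a * (g r) ^ 2 + b) - 2 * φ (f r) (g r) / (ρ + r) * f r) r ∧
    HasDerivAt g (f r * (1 - (g r) ^ 2)) r

/-- The interval `[0, R)` with possibly infinite right endpoint. -/
def edom (R : EReal) : Set ℝ := {r : ℝ | 0 ≤ r ∧ (r : EReal) < R}

/-- `g` changes sign at `r₀` relative to the interval `s`. -/
def ChangesSignAt (g : ℝ → ℝ) (s : Set ℝ) (r₀ : ℝ) : Prop :=
  g r₀ = 0 ∧ ∃ ε > 0, Icc (r₀ - ε) (r₀ + ε) ⊆ s ∧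
    g (r₀ - ε) * g (r₀ + ε) < 0 ∧ ∀ r ∈ Ioo (0 : ℝ) ε, g (r₀ - r) * g (r₀ + r) ≤ 0

/-- `g` changes sign exactly `k` times on `s`. -/
def ChangesSignExactly (g : ℝ → ℝ) (s : Set ℝ) (k : ℕ) : Prop :=
  {r | ChangesSignAt g s r}.Finite ∧ {r | ChangesSignAt g s r}.ncard = k

/-- The set `A_k`, for the family of solutions `x ↦ (F x, G x)`. -/
def Aset (a b : ℝ) (F G : ℝ → ℝ → ℝ) (k : ℕ) : Set ℝ :=
  {x | x ∈ Ioo (0 : ℝ) 1 ∧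
    (∃ L, L < 0 ∧ Tendsto (fun r => Ham a b (F x r) (G x r)) atTop (nhds L)) ∧
    ChangesSignExactly (G x) (Ioi 0) k}

/-- The set `I_k`, for the family of solutions `x ↦ (F x, G x)`. -/
def Iset (a b : ℝ) (F G : ℝ → ℝ → ℝ) (k : ℕ) : Set ℝ :=
  {x | x ∈ Ioo (0 : ℝ) 1 ∧
    Tendsto (fun r => (F x r, G x r)) atTop (nhds ((0 : ℝ), (0 : ℝ))) ∧
    ChangesSignExactly (G x) (Ioi 0) k}

/-- A function with nonpositive derivative on `(u, v)` does not increase from `u` to `v`. -/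
theorem le_of_hasDerivAt_nonpos {p p' : ℝ → ℝ} {u v : ℝ} (huv : u ≤ v)
    (hc : ContinuousOn p (Icc u v)) (hd : ∀ r ∈ Ioo u v, HasDerivAt p (p' r) r)
    (hp : ∀ r ∈ Ioo u v, p' r ≤ 0) : p v ≤ p u := by
  refine antitoneOn_of_hasDerivWithinAt_nonpos (f' := p') (convex_Icc u v) hc ?_ ?_
    (left_mem_Icc.2 huv) (right_mem_Icc.2 huv) huv
  · rw [interior_Icc]; exact fun r hr => (hd r hr).hasDerivWithinAt
  · rw [interior_Icc]; exact hp

theorem le_of_hasDerivAt_nonneg {p p' : ℝ → ℝ} {u v : ℝ} (huv : u ≤ v)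
    (hc : ContinuousOn p (Icc u v)) (hd : ∀ r ∈ Ioo u v, HasDerivAt p (p' r) r)
    (hp : ∀ r ∈ Ioo u v, 0 ≤ p' r) : p u ≤ p v := by
  have := le_of_hasDerivAt_nonpos (p := fun r => -p r) (p' := fun r => -p' r) huv hc.neg
    (fun r hr => (hd r hr).neg) (fun r hr => by linarith [hp r hr])
  linarith

theorem Ham_eq (a b f g : ℝ) :
    Ham a b f g = (a - 2 * b) / 4 - 1 / 4 * (1 - g ^ 2) * (a * g ^ 2 + (a - 2 * b) - 2 * f ^ 2) := by
  unfold Ham; ring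

theorem Ham_neg (a b f g : ℝ) : Ham a b (-f) (-g) = Ham a b f g := by
  unfold Ham; ring

/-- The properties of the cutoff used for a single trajectory. -/
structure IsDamping (a : ℝ) (φ : ℝ → ℝ → ℝ) : Prop where
  nonneg : ∀ f g, 0 ≤ φ f g
  le_one : ∀ f g, φ f g ≤ 1
  neg : ∀ f g, φ (-f) (-g) = φ f g
  eq_one : ∀ f g, f ^ 2 ≤ a / 2 → φ f g = 1

theorem IsCutoff.isDamping {a b η : ℝ} {φ : ℝ → ℝ → ℝ} (hφ : IsCutoff a b η φ)
    (hη : η ∈ Ioo 0 (Real.sqrt (a - b) - Real.sqrt (a / 2))) : IsDamping a φ where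
  nonneg f g := (hφ.1 f g).1
  le_one f g := (hφ.1 f g).2
  neg f g := by rw [hφ.2.2.1 (-f), hφ.2.2.1 f, abs_neg, abs_neg]
  eq_one f g h := by
    refine hφ.2.2.2.2 f g ?_
    have := Real.abs_le_sqrt h
    linarith [hη.2]

/-- A global trajectory of the regularized system, lying strictly inside the region
bounded by the energy level `(a - 2b)/4`, and avoiding the origin. -/
structure IsTraj (a b : ℝ) (φ : ℝ → ℝ → ℝ) (f g : ℝ → ℝ) : Prop where
  cf : ContinuousOn f (Ici 0)
  cg : ContinuousOn g (Ici 0)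
  df : ∀ r, 0 < r →
    HasDerivAt f (g r * ((f r) ^ 2 - a * (g r) ^ 2 + b) - 2 * φ (f r) (g r) / r * f r) r
  dg : ∀ r, 0 < r → HasDerivAt g (f r * (1 - (g r) ^ 2)) r
  sq_lt : ∀ r, 0 ≤ r → g r ^ 2 < 1
  ham_lt : ∀ r, 0 ≤ r → Ham a b (f r) (g r) < (a - 2 * b) / 4
  ne_zero : ∀ r, 0 < r → g r = 0 → f r ≠ 0

theorem IsTraj.neg {a b : ℝ} {φ : ℝ → ℝ → ℝ} {f g : ℝ → ℝ} (hφ : IsDamping a φ)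
    (h : IsTraj a b φ f g) : IsTraj a b φ (fun r => -f r) (fun r => -g r) where
  cf := h.cf.neg
  cg := h.cg.neg
  df r hr := by
    have := (h.df r hr).fun_neg
    rw [hφ.neg]
    exact this.congr_deriv (by ring)
  dg r hr := by
    exact (h.dg r hr).fun_neg.congr_deriv (by ring)
  sq_lt r hr := by rw [neg_sq]; exact h.sq_lt r hr
  ham_lt r hr := by rw [Ham_neg]; exact h.ham_lt r hr
  ne_zero r hr h0 := by
    have := h.ne_zero r hr (by linarith)
    simpa using this

theorem hasDerivAt_Ham {a b c r : ℝ} {f g : ℝ → ℝ}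
    (df : HasDerivAt f (g r * ((f r) ^ 2 - a * (g r) ^ 2 + b) - c * f r) r)
    (dg : HasDerivAt g (f r * (1 - (g r) ^ 2)) r) :
    HasDerivAt (fun r => Ham a b (f r) (g r)) (-c * ((f r) ^ 2 * (1 - (g r) ^ 2))) r := by
  have := ((((df.fun_pow 2).const_mul (1 / 2)).fun_mul ((dg.fun_pow 2).const_sub 1)).fun_add
    ((dg.fun_pow 4).const_mul (a / 4))).fun_sub ((dg.fun_pow 2).const_mul (b / 2))
  unfold Ham
  refine this.congr_deriv ?_
  ring

theorem continuousOn_Ham {a b : ℝ} {f g : ℝ → ℝ} {s : Set ℝ} (cf : ContinuousOn f s)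
    (cg : ContinuousOn g s) : ContinuousOn (fun r => Ham a b (f r) (g r)) s := by
  unfold Ham
  fun_prop

/-- `1 - g²` stays positive along solutions of `g' = f (1 - g²)`. -/
theorem sq_lt_one_of_hasDerivAt {f g : ℝ → ℝ} (cf : ContinuousOn f (Ici 0))
    (cg : ContinuousOn g (Ici 0)) (dg : ∀ r, 0 < r → HasDerivAt g (f r * (1 - (g r) ^ 2)) r)
    (h0 : g 0 ^ 2 < 1) {r : ℝ} (hr : 0 ≤ r) : g r ^ 2 < 1 := by
  set q : ℝ → ℝ := fun t => 2 * f (max t 0) * g (max t 0) with hq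
  have hm : ∀ t : ℝ, max t 0 ∈ Ici (0 : ℝ) := fun t => le_max_right t 0
  have cq : Continuous q := by
    have h1 : Continuous fun t : ℝ => f (max t 0) :=
      cf.comp_continuous (by fun_prop) hm
    have h2 : Continuous fun t : ℝ => g (max t 0) :=
      cg.comp_continuous (by fun_prop) hm
    exact (continuous_const.mul h1).mul h2
  set P : ℝ → ℝ := fun t => ∫ s in (0 : ℝ)..t, q s with hP
  have dP : ∀ t, HasDerivAt P (q t) t := fun t =>
    intervalIntegral.integral_hasDerivAt_right (cq.intervalIntegrable _ _)
      cq.aestronglyMeasurable.stronglyMeasurableAtFilter cq.continuousAt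
  have cP : Continuous P := continuous_iff_continuousAt.2 fun t => (dP t).continuousAt
  have key : (1 - g 0 ^ 2) * Real.exp (P 0) ≤ (1 - g r ^ 2) * Real.exp (P r) := by
    refine le_of_hasDerivAt_nonneg (p := fun t => (1 - g t ^ 2) * Real.exp (P t))
      (p' := fun _ => 0) hr ?_ ?_ (fun _ _ => le_rfl)
    · have : ContinuousOn g (Icc 0 r) := cg.mono Icc_subset_Ici_self
      exact (continuousOn_const.sub (this.pow 2)).mul (cP.rexp.continuousOn)
    · intro t ht
      have := ((((dg t ht.1).fun_pow 2).const_sub 1)).fun_mul (dP t).exp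
      refine this.congr_deriv ?_
      simp only [hq, max_eq_left ht.1.le]
      ring
  have h1 : 0 < (1 - g 0 ^ 2) * Real.exp (P 0) := mul_pos (by linarith) (Real.exp_pos _)
  have h2 := pos_of_mul_pos_left (h1.trans_le key) (Real.exp_pos _).le
  linarith

section Traj

variable {a b : ℝ} {φ : ℝ → ℝ → ℝ} {f g : ℝ → ℝ}

theorem f_sq_lt_of_Ham_lt {f g : ℝ} (ha : 0 < a) (hg : g ^ 2 < 1)
    (hH : Ham a b f g < (a - 2 * b) / 4) : f ^ 2 < a - b := by
  rw [Ham_eq] at hH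
  have h1 : 0 < (1 - g ^ 2) * (a * g ^ 2 + (a - 2 * b) - 2 * f ^ 2) := by linarith
  have h2 := pos_of_mul_pos_right h1 (by linarith)
  nlinarith

theorem IsRegSolOn.isTraj {x : ℝ} (hb : 0 < b) (hab : 2 * b < a) (hφ : IsDamping a φ)
    (hx : x ∈ Ioo (0 : ℝ) 1) (h : IsRegSolOn a b φ x f g (Ici 0)) : IsTraj a b φ f g := by
  obtain ⟨hf0, hg0, cf, cg, hd⟩ := h
  have df := fun r (hr : 0 < r) => (hd r hr.le hr).1
  have dg := fun r (hr : 0 < r) => (hd r hr.le hr).2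
  have hg0' : g 0 ^ 2 < 1 := by rw [hg0]; nlinarith [hx.1, hx.2]
  have hsq : ∀ r, 0 ≤ r → g r ^ 2 < 1 := fun r hr => sq_lt_one_of_hasDerivAt cf cg dg hg0' hr
  have hH : ∀ r, 0 ≤ r → Ham a b (f r) (g r) < (a - 2 * b) / 4 := by
    intro r hr
    have h1 : Ham a b (f r) (g r) ≤ Ham a b (f 0) (g 0) := by
      refine le_of_hasDerivAt_nonpos (p := fun r => Ham a b (f r) (g r)) hr
        (continuousOn_Ham (cf.mono Icc_subset_Ici_self) (cg.mono Icc_subset_Ici_self))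
        (fun t ht => hasDerivAt_Ham (df t ht.1) (dg t ht.1)) ?_
      intro t ht
      have h1 := div_nonneg (mul_nonneg zero_le_two (hφ.nonneg (f t) (g t))) ht.1.le
      have h2 := hsq t ht.1.le
      have := mul_nonneg h1 (mul_nonneg (sq_nonneg (f t)) (by linarith : 0 ≤ 1 - g t ^ 2))
      linarith
    refine h1.trans_lt ?_
    rw [Ham_eq, hf0]
    have : 0 < (1 - g 0 ^ 2) * (a * g 0 ^ 2 + (a - 2 * b) - 2 * 0 ^ 2) :=
      mul_pos (by linarith) (by nlinarith [sq_nonneg (g 0)])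
    linarith
  refine ⟨cf, cg, df, dg, hsq, hH, ?_⟩
  intro r1 hr1 hgz hfz
  -- the energy `f² + g²` is at most exponentially decreasing, so it cannot reach zero
  have key : ∀ r ∈ Ioo 0 r1, g r = 0 := by
    intro r0 hr0
    set K : ℝ := 2 * a + 2 * b + 1 + 4 / r0 with hK
    have h1 : (f r0 ^ 2 + g r0 ^ 2) * Real.exp (K * r0) ≤
        (f r1 ^ 2 + g r1 ^ 2) * Real.exp (K * r1) := by
      have hsub : Icc r0 r1 ⊆ Ici 0 := fun t ht => hr0.1.le.trans ht.1
      have cf' := cf.mono hsub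
      have cg' := cg.mono hsub
      refine le_of_hasDerivAt_nonneg
        (p := fun t => (f t ^ 2 + g t ^ 2) * Real.exp (K * t)) hr0.2.le (by fun_prop)
        (fun t ht => (((df t (hr0.1.trans ht.1)).fun_pow 2).fun_add
          ((dg t (hr0.1.trans ht.1)).fun_pow 2)).fun_mul ((hasDerivAt_id t).const_mul K).exp) ?_
      intro t ht
      have ht0 : 0 < t := hr0.1.trans ht.1
      have hfb := f_sq_lt_of_Ham_lt (by linarith) (hsq t ht0.le) (hH t ht0.le)
      have hgb := hsq t ht0.le
      set X := f t
      set Y := g t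
      set p := φ X Y / t with hp
      have hp0 : 0 ≤ p := div_nonneg (hφ.nonneg _ _) ht0.le
      have hp1 : p ≤ 1 / r0 := by
        rw [hp]
        exact div_le_div₀ zero_le_one (hφ.le_one _ _) hr0.1 ht.1.le
      have e1 : 2 * φ X Y / t = 2 * p := by rw [hp]; ring
      have e2 : K = 2 * a + 2 * b + 1 + 4 * (1 / r0) := by rw [hK]; ring
      have hXY : |X * Y| ≤ (X ^ 2 + Y ^ 2) / 2 := by
        rw [abs_le]; constructor <;> nlinarith [sq_nonneg (X - Y), sq_nonneg (X + Y)]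
      have hc : |X ^ 2 - a * Y ^ 2 + b + (1 - Y ^ 2)| ≤ 2 * a + 2 * b + 1 := by
        rw [abs_le]; constructor <;> nlinarith [sq_nonneg X, sq_nonneg Y]
      have hm : |X * Y * (X ^ 2 - a * Y ^ 2 + b + (1 - Y ^ 2))| ≤
          (X ^ 2 + Y ^ 2) / 2 * (2 * a + 2 * b + 1) := by
        rw [abs_mul]
        exact mul_le_mul hXY hc (abs_nonneg _) (by positivity)
      have hm' := (abs_le.1 hm).1
      have hpX : p * X ^ 2 ≤ 1 / r0 * (X ^ 2 + Y ^ 2) := by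
        refine (mul_le_mul_of_nonneg_right hp1 (sq_nonneg X)).trans ?_
        refine mul_le_mul_of_nonneg_left ?_ (by have := hr0.1; positivity)
        nlinarith [sq_nonneg Y]
      have : 0 ≤ Real.exp (K * t) * (2 * (X * Y * (X ^ 2 - a * Y ^ 2 + b + (1 - Y ^ 2)))
          - 4 * (p * X ^ 2) + K * (X ^ 2 + Y ^ 2)) := by
        refine mul_nonneg (Real.exp_pos _).le ?_
        rw [e2]
        linarith
      rw [e1]
      refine this.trans_eq ?_
      simp only [id, Nat.cast_ofNat]
      ring
    rw [hgz, hfz] at h1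
    have h2 : f r0 ^ 2 + g r0 ^ 2 ≤ 0 := by
      by_contra! hcon
      have := mul_pos hcon (Real.exp_pos (K * r0))
      norm_num at h1
      linarith
    nlinarith [sq_nonneg (f r0), sq_nonneg (g r0)]
  have h0 : Tendsto g (𝓝[Ioi 0] 0) (𝓝 x) := by
    have := (cg 0 self_mem_Ici).mono Ioi_subset_Ici_self
    rw [← hg0]; exact this
  have h1 : Tendsto g (𝓝[Ioi 0] 0) (𝓝 0) := by
    refine (tendsto_const_nhds (x := (0 : ℝ))).congr' ?_
    filter_upwards [Ioo_mem_nhdsGT hr1] with r hr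
    exact (key r hr).symm
  have := tendsto_nhds_unique h0 h1
  linarith [hx.1]

end Traj

namespace IsTraj

variable {a b : ℝ} {φ : ℝ → ℝ → ℝ} {f g : ℝ → ℝ}

theorem cf_Icc (h : IsTraj a b φ f g) {u v : ℝ} (hu : 0 ≤ u) : ContinuousOn f (Icc u v) :=
  h.cf.mono fun _ ht => hu.trans ht.1

theorem cg_Icc (h : IsTraj a b φ f g) {u v : ℝ} (hu : 0 ≤ u) : ContinuousOn g (Icc u v) :=
  h.cg.mono fun _ ht => hu.trans ht.1

theorem hasDerivAt_Ham (h : IsTraj a b φ f g) {r : ℝ} (hr : 0 < r) :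
    HasDerivAt (fun r => Ham a b (f r) (g r))
      (-(2 * φ (f r) (g r) / r) * ((f r) ^ 2 * (1 - (g r) ^ 2))) r :=
  _root_.hasDerivAt_Ham (h.df r hr) (h.dg r hr)

theorem Ham_le (hφ : IsDamping a φ) (h : IsTraj a b φ f g) {u v : ℝ} (hu : 0 ≤ u)
    (huv : u ≤ v) : Ham a b (f v) (g v) ≤ Ham a b (f u) (g u) := by
  refine le_of_hasDerivAt_nonpos (p := fun r => Ham a b (f r) (g r)) huv
    (continuousOn_Ham (h.cf_Icc hu) (h.cg_Icc hu))
    (fun t ht => h.hasDerivAt_Ham (hu.trans_lt ht.1)) ?_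
  intro t ht
  have ht0 : 0 ≤ t := hu.trans ht.1.le
  have h1 := div_nonneg (mul_nonneg zero_le_two (hφ.nonneg (f t) (g t))) ht0
  have h2 := h.sq_lt t ht0
  have := mul_nonneg h1 (mul_nonneg (sq_nonneg (f t)) (by linarith : 0 ≤ 1 - g t ^ 2))
  linarith

theorem f_sq_lt (ha : 0 < a) (h : IsTraj a b φ f g) {r : ℝ} (hr : 0 ≤ r) : f r ^ 2 < a - b :=
  f_sq_lt_of_Ham_lt ha (h.sq_lt r hr) (h.ham_lt r hr)

theorem abs_f_le (ha : 0 < a) (h : IsTraj a b φ f g) {r : ℝ} (hr : 0 ≤ r) :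
    |f r| ≤ Real.sqrt (a - b) :=
  Real.abs_le_sqrt (h.f_sq_lt ha hr).le

theorem abs_g_lt (h : IsTraj a b φ f g) {r : ℝ} (hr : 0 ≤ r) : |g r| < 1 :=
  (sq_lt_one_iff_abs_lt_one _).1 (h.sq_lt r hr)

/-- At a zero of `f` where the energy is nonnegative and `g ≠ 0`, one has `g² ≥ 2b/a`. -/
theorem two_mul_le_of_Ham_nonneg {f g : ℝ} (hf : f = 0) (hg : g ≠ 0)
    (hH : 0 ≤ Ham a b f g) : 2 * b ≤ a * g ^ 2 := by
  have hg2 : 0 < g ^ 2 := by positivity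
  unfold Ham at hH
  rw [hf] at hH
  by_contra! hcon
  nlinarith [mul_pos hg2 (sub_pos.2 hcon)]

theorem f_nonpos (hb : 0 < b) (h : IsTraj a b φ f g) {c v : ℝ} (hc : 0 < c)
    (hg : ∀ r ∈ Icc c v, 0 ≤ g r) (hH : ∀ r ∈ Icc c v, 0 ≤ Ham a b (f r) (g r))
    (hfc : f c ≤ 0) : ∀ r ∈ Icc c v, f r ≤ 0 := by
  intro r hr
  refine image_le_of_deriv_right_lt_deriv_boundary' (B := fun _ => 0) (B' := fun _ => 0)
    (h.cf_Icc hc.le) (fun t ht => (h.df t (hc.trans_le ht.1)).hasDerivWithinAt) hfc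
    continuousOn_const (fun t _ => hasDerivWithinAt_const _ _ _) ?_ hr
  intro t ht hft
  have ht' : t ∈ Icc c v := Ico_subset_Icc_self ht
  have hgne : g t ≠ 0 := fun h0 => h.ne_zero t (hc.trans_le ht.1) h0 hft
  have hgpos : 0 < g t := lt_of_le_of_ne (hg t ht') hgne.symm
  have := two_mul_le_of_Ham_nonneg hft hgne (hH t ht')
  rw [hft]
  nlinarith

/-- While `g` has a sign and the energy is nonnegative, `f` changes sign at most once. -/
theorem exists_f_sign (hb : 0 < b) (h : IsTraj a b φ f g) {u v : ℝ} (hu : 0 < u) (huv : u ≤ v)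
    (hg : ∀ r ∈ Icc u v, 0 ≤ g r) (hH : ∀ r ∈ Icc u v, 0 ≤ Ham a b (f r) (g r)) :
    ∃ c ∈ Icc u v, (∀ r ∈ Ioo u c, 0 ≤ f r) ∧ ∀ r ∈ Ioo c v, f r ≤ 0 := by
  by_cases hpos : ∀ r ∈ Icc u v, 0 < f r
  · exact ⟨v, right_mem_Icc.2 huv, fun r hr => (hpos r ⟨hr.1.le, hr.2.le⟩).le,
      fun r hr => absurd (hr.1.trans hr.2) (lt_irrefl _)⟩
  · push Not at hpos
    obtain ⟨r0, hr0, hfr0⟩ := hpos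
    set S : Set ℝ := {r | r ∈ Icc u v ∧ f r ≤ 0} with hS
    have hSb : BddBelow S := ⟨u, fun r hr => hr.1.1⟩
    have hSne : S.Nonempty := ⟨r0, hr0, hfr0⟩
    have hcu : u ≤ sInf S := le_csInf hSne fun r hr => hr.1.1
    have hcv : sInf S ≤ v := (csInf_le hSb ⟨hr0, hfr0⟩).trans hr0.2
    refine ⟨sInf S, ⟨hcu, hcv⟩, ?_, ?_⟩
    · intro r hr
      by_contra! hcon
      have := csInf_le hSb (show r ∈ S from ⟨⟨hr.1.le, hr.2.le.trans hcv⟩, hcon.le⟩)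
      exact absurd this (not_le.2 hr.2)
    · intro r hr
      obtain ⟨s, hs, hsr⟩ := exists_lt_of_csInf_lt hSne hr.1
      have hsub : Icc s v ⊆ Icc u v := Icc_subset_Icc_left hs.1.1
      exact h.f_nonpos hb (hu.trans_le hs.1.1) (fun t ht => hg t (hsub ht))
        (fun t ht => hH t (hsub ht)) hs.2 r ⟨hsr.le, hr.2.le⟩

/-- The dissipation along a monotone branch of `g` is bounded by its variation. -/
theorem dissipation_mono (ha : 0 < a) (hφ : IsDamping a φ) (h : IsTraj a b φ f g) {T u v : ℝ}
    (hT : 0 < T) (hTu : T ≤ u) (huv : u ≤ v) (hf : ∀ r ∈ Ioo u v, 0 ≤ f r) :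
    Ham a b (f u) (g u) - Ham a b (f v) (g v) ≤
      2 * Real.sqrt (a - b) / T * (g v - g u) := by
  have hu : 0 < u := hT.trans_le hTu
  set C := Real.sqrt (a - b)
  have := le_of_hasDerivAt_nonneg (p := fun r => Ham a b (f r) (g r) + 2 * C / T * g r) huv
    ((continuousOn_Ham (h.cf_Icc hu.le) (h.cg_Icc hu.le)).add
      (continuousOn_const.mul (h.cg_Icc hu.le)))
    (fun t ht => (h.hasDerivAt_Ham (hu.trans ht.1)).fun_add
      ((h.dg t (hu.trans ht.1)).const_mul _)) ?_
  · linarith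
  intro t ht
  have ht0 : 0 < t := hu.trans ht.1
  have h1 : 2 * φ (f t) (g t) / t * f t ≤ 2 * C / T := by
    have e1 : 2 * φ (f t) (g t) * f t ≤ 2 * C := by
      have := mul_le_mul (hφ.le_one (f t) (g t)) ((le_abs_self _).trans (h.abs_f_le ha ht0.le))
        (hf t ht) zero_le_one
      linarith
    rw [div_mul_eq_mul_div]
    exact div_le_div₀ (by positivity) e1 hT (hTu.trans ht.1.le)
  have h2 : 0 ≤ f t * (1 - g t ^ 2) :=
    mul_nonneg (hf t ht) (by linarith [h.sq_lt t ht0.le])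
  have := mul_nonneg (sub_nonneg.2 h1) h2
  linarith

theorem dissipation_anti (ha : 0 < a) (hφ : IsDamping a φ) (h : IsTraj a b φ f g) {T u v : ℝ}
    (hT : 0 < T) (hTu : T ≤ u) (huv : u ≤ v) (hf : ∀ r ∈ Ioo u v, f r ≤ 0) :
    Ham a b (f u) (g u) - Ham a b (f v) (g v) ≤
      2 * Real.sqrt (a - b) / T * (g u - g v) := by
  have := (h.neg hφ).dissipation_mono ha hφ hT hTu huv (fun r hr => by linarith [hf r hr])
  rw [Ham_neg, Ham_neg] at this
  linarith

/-- The energy lost between two consecutive zeros of `g` after time `T` is `O(1/T)`. -/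
theorem dissipation_le_of_nonneg (ha : 0 < a) (hb : 0 < b) (hφ : IsDamping a φ)
    (h : IsTraj a b φ f g) {T u v : ℝ} (hT : 0 < T) (hTu : T ≤ u) (huv : u ≤ v)
    (hg : ∀ r ∈ Icc u v, 0 ≤ g r) (hH : ∀ r ∈ Icc u v, 0 ≤ Ham a b (f r) (g r)) :
    Ham a b (f u) (g u) - Ham a b (f v) (g v) ≤ 4 * Real.sqrt (a - b) / T := by
  have hu : 0 < u := hT.trans_le hTu
  obtain ⟨c, hc, h1, h2⟩ := h.exists_f_sign hb hu huv hg hH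
  have e1 := h.dissipation_mono ha hφ hT hTu hc.1 h1
  have e2 := h.dissipation_anti ha hφ hT (hTu.trans hc.1) hc.2 h2
  have hg1 := (abs_lt.1 (h.abs_g_lt (hu.le.trans hc.1))).2
  have hgu := hg u (left_mem_Icc.2 huv)
  have hgv := hg v (right_mem_Icc.2 huv)
  have hq : 0 ≤ 2 * Real.sqrt (a - b) / T := by positivity
  have : 2 * Real.sqrt (a - b) / T * (2 * g c - g u - g v) ≤ 2 * Real.sqrt (a - b) / T * 2 :=
    mul_le_mul_of_nonneg_left (by linarith) hq
  have e3 : 4 * Real.sqrt (a - b) / T = 2 * Real.sqrt (a - b) / T * 2 := by ring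
  linarith

theorem dissipation_le_of_ne (ha : 0 < a) (hb : 0 < b) (hφ : IsDamping a φ)
    (h : IsTraj a b φ f g) {T u v : ℝ} (hT : 0 < T) (hTu : T ≤ u) (huv : u ≤ v)
    (hg : ∀ r ∈ Ioo u v, g r ≠ 0) (hH : ∀ r ∈ Icc u v, 0 ≤ Ham a b (f r) (g r)) :
    Ham a b (f u) (g u) - Ham a b (f v) (g v) ≤ 4 * Real.sqrt (a - b) / T := by
  have hu : 0 < u := hT.trans_le hTu
  rcases huv.eq_or_lt with rfl | huv'
  · rw [sub_self]; positivity
  have hcl : closure (Ioo u v) = Icc u v := closure_Ioo huv'.ne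
  have hcg : ContinuousOn g (closure (Ioo u v)) := hcl ▸ h.cg_Icc hu.le
  have hsign : (∀ r ∈ Ioo u v, 0 < g r) ∨ ∀ r ∈ Ioo u v, g r < 0 := by
    by_contra! hcon
    obtain ⟨⟨r1, hr1, h1⟩, r2, hr2, h2⟩ := hcon
    obtain ⟨z, hz, hz0⟩ := isPreconnected_Ioo.intermediate_value hr1 hr2
      (hcg.mono subset_closure) ⟨h1, h2⟩
    exact hg z hz hz0
  rcases hsign with hs | hs
  · refine h.dissipation_le_of_nonneg ha hb hφ hT hTu huv (fun r hr => ?_) hH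
    rw [← hcl] at hr
    exact le_on_closure (fun x hx => (hs x hx).le) continuousOn_const hcg hr
  · have := (h.neg hφ).dissipation_le_of_nonneg ha hb hφ hT hTu huv (fun r hr => ?_) ?_
    · rwa [Ham_neg, Ham_neg] at this
    · rw [← hcl] at hr
      have := le_on_closure (fun x hx => (hs x hx).le) hcg continuousOn_const hr
      linarith
    · intro r hr
      rw [Ham_neg]
      exact hH r hr

theorem dissipation_le_ncard (ha : 0 < a) (hb : 0 < b) (hφ : IsDamping a φ)
    (h : IsTraj a b φ f g) {T : ℝ} (hT : 0 < T) (n : ℕ) : ∀ {u v : ℝ}, T ≤ u → u ≤ v →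
    (∀ r ∈ Icc u v, 0 ≤ Ham a b (f r) (g r)) →
    {r | r ∈ Ioo u v ∧ g r = 0}.Finite → {r | r ∈ Ioo u v ∧ g r = 0}.ncard = n →
    Ham a b (f u) (g u) - Ham a b (f v) (g v) ≤ (n + 1) * (4 * Real.sqrt (a - b) / T) := by
  induction n using Nat.strong_induction_on with
  | _ n ih =>
  intro u v hTu huv hH hfin hcard
  by_cases hne : ∀ r ∈ Ioo u v, g r ≠ 0
  · refine (h.dissipation_le_of_ne ha hb hφ hT hTu huv hne hH).trans ?_
    have h1 : 0 ≤ 4 * Real.sqrt (a - b) / T := by positivity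
    have h2 : (0 : ℝ) ≤ n := n.cast_nonneg
    nlinarith
  · push Not at hne
    obtain ⟨z, hz, hgz⟩ := hne
    set A := {r | r ∈ Ioo u z ∧ g r = 0} with hA
    set B := {r | r ∈ Ioo z v ∧ g r = 0} with hB
    have hAs : A ⊆ {r | r ∈ Ioo u v ∧ g r = 0} := fun r hr => ⟨⟨hr.1.1, hr.1.2.trans hz.2⟩, hr.2⟩
    have hBs : B ⊆ {r | r ∈ Ioo u v ∧ g r = 0} := fun r hr => ⟨⟨hz.1.trans hr.1.1, hr.1.2⟩, hr.2⟩
    have hAf := hfin.subset hAs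
    have hBf := hfin.subset hBs
    have hAB : Disjoint A B := by
      rw [Set.disjoint_left]
      exact fun r hr hr' => absurd (hr.1.2.trans hr'.1.1) (lt_irrefl _)
    have hzAB : z ∉ A ∪ B := by
      rintro (hr | hr)
      · exact lt_irrefl _ hr.1.2
      · exact lt_irrefl _ hr.1.1
    have hun : insert z (A ∪ B) = {r | r ∈ Ioo u v ∧ g r = 0} := by
      refine Subset.antisymm (insert_subset ⟨hz, hgz⟩ (union_subset hAs hBs)) ?_
      rintro r ⟨hr, hgr⟩
      rcases lt_trichotomy r z with hlt | heq | hgt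
      · exact Or.inr (Or.inl ⟨⟨hr.1, hlt⟩, hgr⟩)
      · exact Or.inl heq
      · exact Or.inr (Or.inr ⟨⟨hgt, hr.2⟩, hgr⟩)
    have hcount : A.ncard + B.ncard + 1 = n := by
      rw [← hcard, ← hun, Set.ncard_insert_of_notMem hzAB (hAf.union hBf),
        Set.ncard_union_eq hAB hAf hBf]
    have e1 := ih A.ncard (by omega) hTu hz.1.le
      (fun r hr => hH r ⟨hr.1, hr.2.trans hz.2.le⟩) hAf rfl
    have e2 := ih B.ncard (by omega) (hTu.trans hz.1.le) hz.2.le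
      (fun r hr => hH r ⟨hz.1.le.trans hr.1, hr.2⟩) hBf rfl
    have e3 : (A.ncard : ℝ) + B.ncard + 1 = n := by exact_mod_cast hcount
    rw [← e3]
    linarith

/-- At low energy the cutoff is inactive. -/
theorem eq_one_of_Ham_le (hφ : IsDamping a φ) {f g ε : ℝ} (hb : 0 < b) (hab : 2 * b < a)
    (hε : ε = (a ^ 2 - (b + a / 2) ^ 2) / (4 * a)) (hg : g ^ 2 < 1)
    (hH : Ham a b f g ≤ ε) : φ f g = 1 := by
  refine hφ.eq_one f g ?_
  have ha : 0 < a := by linarith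
  have e : 4 * a * ε = a ^ 2 - (b + a / 2) ^ 2 := by rw [hε]; field_simp
  unfold Ham at hH
  by_contra! hcon
  have h1 : 0 < 1 - g ^ 2 := by linarith
  have h2 := mul_lt_mul_of_pos_right hcon h1
  have h3 : a / 2 * (1 - g ^ 2) + a / 2 * g ^ 4 - b * g ^ 2 < 2 * ε := by nlinarith
  have h4 : a * (a * (1 - g ^ 2) + a * g ^ 4 - 2 * b * g ^ 2) <
      a ^ 2 - (b + a / 2) ^ 2 := by
    rw [← e]; nlinarith
  nlinarith [sq_nonneg (a * g ^ 2 - (b + a / 2))]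

theorem level_pos (hb : 0 < b) (hab : 2 * b < a) :
    0 < (a ^ 2 - (b + a / 2) ^ 2) / (4 * a) := by
  have ha : 0 < a := by linarith
  apply div_pos _ (by linarith)
  nlinarith

/-- After time `R`, if the trajectory starts close enough to the origin relative to `1/R`, then
`a g² < b` as long as the energy stays nonnegative. -/
theorem g_sq_lt_of_small (hb : 0 < b) (hab : 2 * b < a) (hφ : IsDamping a φ)
    (h : IsTraj a b φ f g) {R v : ℝ} (hR : 0 < R)
    (hHR : Ham a b (f R) (g R) ≤ (a ^ 2 - (b + a / 2) ^ 2) / (4 * a))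
    (hsmall : R * Ham a b (f R) (g R) + Real.sqrt b * |g R| ^ 3 / 3 <
      Real.sqrt b * Real.sqrt (b / a) ^ 3 / 3)
    (hH : 0 ≤ Ham a b (f v) (g v)) : ∀ r ∈ Icc R v, a * g r ^ 2 < b := by
  have ha : 0 < a := by linarith
  by_contra! hcon
  obtain ⟨r0, hr0, hgr0⟩ := hcon
  -- first time at which `a g² = b`
  set S : Set ℝ := {r | r ∈ Icc R v ∧ b ≤ a * g r ^ 2} with hS
  have hSc : IsClosed S := by
    have : S = Icc R v ∩ (fun r => a * g r ^ 2) ⁻¹' (Ici b) := rfl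
    rw [this]
    exact (continuousOn_const.mul ((h.cg_Icc hR.le).pow 2)).preimage_isClosed_of_isClosed
      isClosed_Icc isClosed_Ici
  have hSb : BddBelow S := ⟨R, fun r hr => hr.1.1⟩
  have hSne : S.Nonempty := ⟨r0, hr0, hgr0⟩
  have ht := hSc.csInf_mem hSne hSb
  set t := sInf S
  have hlt : ∀ r ∈ Ioo R t, a * g r ^ 2 < b := by
    intro r hr
    by_contra! hc
    exact absurd (csInf_le hSb (show r ∈ S from ⟨⟨hr.1.le, hr.2.le.trans ht.1.2⟩, hc⟩))
      (not_le.2 hr.2)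
  have hb2 : Real.sqrt b ^ 2 = b := Real.sq_sqrt hb.le
  set κ := Real.sqrt b
  have hκ : 0 < κ := Real.sqrt_pos.2 hb
  have key : ∀ {f g : ℝ → ℝ}, IsTraj a b φ f g → (∀ r ∈ Ioo R t, a * g r ^ 2 < b) →
      Ham a b (f R) (g R) ≤ (a ^ 2 - (b + a / 2) ^ 2) / (4 * a) →
      t * Ham a b (f t) (g t) + κ / 3 * g t ^ 3 ≤ R * Ham a b (f R) (g R) + κ / 3 * g R ^ 3 := by
    intro f g h hlt hHR
    refine le_of_hasDerivAt_nonpos (p := fun r => r * Ham a b (f r) (g r) + κ / 3 * g r ^ 3)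
      ht.1.1 ?_ (fun r hr => ((hasDerivAt_id r).fun_mul
        (h.hasDerivAt_Ham (hR.trans hr.1))).fun_add
        (((h.dg r (hR.trans hr.1)).fun_pow 3).const_mul (κ / 3))) ?_
    · exact (continuousOn_id.mul (continuousOn_Ham (h.cf_Icc hR.le) (h.cg_Icc hR.le))).add
        (continuousOn_const.mul ((h.cg_Icc hR.le).pow 3))
    · intro r hr
      have hr0 : 0 < r := hR.trans hr.1
      have hg1 := h.sq_lt r hr0.le
      rw [eq_one_of_Ham_le hφ hb hab rfl hg1 ((h.Ham_le hφ hR.le hr.1.le).trans hHR)]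
      have hgb := hlt r hr
      unfold Ham
      set X := f r
      set Y := g r
      have e1 : id r * (-(2 * 1 / r) * (X ^ 2 * (1 - Y ^ 2))) = - 2 * (X ^ 2 * (1 - Y ^ 2)) := by
        simp only [id]; field_simp
      rw [e1]
      simp only [Nat.cast_ofNat]
      have h1 : 0 < 1 - Y ^ 2 := by linarith
      have h2 : 0 ≤ (X - κ * Y ^ 2 / 3) ^ 2 * (1 - Y ^ 2) := mul_nonneg (sq_nonneg _) h1.le
      have h3 : 0 ≤ X ^ 2 * (1 - Y ^ 2) := mul_nonneg (sq_nonneg _) h1.le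
      have h4 : 0 ≤ Y ^ 2 * (b - a * Y ^ 2) := mul_nonneg (sq_nonneg _) (by linarith)
      have h5 : κ ^ 2 * Y ^ 4 * (1 - Y ^ 2) ≤ b * Y ^ 2 := by
        rw [hb2]
        have : Y ^ 4 * (1 - Y ^ 2) ≤ Y ^ 2 := by nlinarith [sq_nonneg (Y ^ 2), sq_nonneg Y, sq_nonneg (Y^3)]
        nlinarith
      norm_num
      nlinarith
  have hpos : 0 ≤ t * Ham a b (f t) (g t) :=
    mul_nonneg (hR.le.trans ht.1.1) (hH.trans (h.Ham_le hφ (hR.le.trans ht.1.1) ht.1.2))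
  have k1 := key h hlt hHR
  have k2 := key (h.neg hφ) (fun r hr => by rw [neg_sq]; exact hlt r hr) (by rwa [Ham_neg])
  rw [Ham_neg, Ham_neg] at k2
  have hgt : Real.sqrt (b / a) ^ 3 ≤ |g t| ^ 3 := by
    refine pow_le_pow_left₀ (Real.sqrt_nonneg _) ?_ 3
    refine Real.sqrt_le_iff.2 ⟨abs_nonneg _, ?_⟩
    rw [sq_abs, div_le_iff₀ ha]
    linarith [ht.2]
  have hle : κ / 3 * |g t| ^ 3 ≤ R * Ham a b (f R) (g R) + κ / 3 * |g R| ^ 3 := by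
    have m1 : g R ^ 3 ≤ |g R| ^ 3 := by rw [← abs_pow]; exact le_abs_self _
    have m2 : -(g R ^ 3) ≤ |g R| ^ 3 := by rw [← abs_pow]; exact neg_le_abs _
    have m1' := mul_le_mul_of_nonneg_left m1 (by positivity : 0 ≤ κ / 3)
    have m2' := mul_le_mul_of_nonneg_left m2 (by positivity : 0 ≤ κ / 3)
    rcases abs_cases (g t) with ⟨e, _⟩ | ⟨e, _⟩
    · rw [e]; linarith
    · rw [e]; linarith
  have := mul_le_mul_of_nonneg_left hgt (by positivity : 0 ≤ κ / 3)
  linarith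

/-- Under the same smallness condition `g` has at most one zero after time `R`. -/
theorem zero_unique_of_small (hb : 0 < b) (hab : 2 * b < a) (hφ : IsDamping a φ)
    (h : IsTraj a b φ f g) {R : ℝ} (hR : 0 < R)
    (hHR : Ham a b (f R) (g R) ≤ (a ^ 2 - (b + a / 2) ^ 2) / (4 * a))
    (hsmall : R * Ham a b (f R) (g R) + Real.sqrt b * |g R| ^ 3 / 3 <
      Real.sqrt b * Real.sqrt (b / a) ^ 3 / 3)
    {r1 r2 : ℝ} (h1 : R ≤ r1) (h12 : r1 < r2) (hg1 : g r1 = 0) (hg2 : g r2 = 0) : False := by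
  have hr1 : 0 < r1 := hR.trans_le h1
  have hH2 : 0 ≤ Ham a b (f r2) (g r2) := by
    rw [hg2]; unfold Ham; nlinarith [sq_nonneg (f r2)]
  have hlt := h.g_sq_lt_of_small hb hab hφ hR hHR hsmall hH2
  have hne : f r1 ≠ 0 := h.ne_zero r1 hr1 hg1
  have hder := h.dg r1 hr1
  rw [hg1] at hder
  have hev := hder.eventually_ne (c := 0) (by simpa using hne)
  obtain ⟨z, hz⟩ : ∃ z ∈ Ioo r1 r2, g z ≠ 0 := by
    have := (hev.filter_mono (nhdsWithin_mono r1 (fun x (hx : x ∈ Ioi r1) => ne_of_gt hx))).and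
      (Ioo_mem_nhdsGT h12)
    obtain ⟨z, hz⟩ := this.exists
    exact ⟨z, hz.2, hz.1⟩
  -- maximum of `g²` on `[r1, r2]`
  obtain ⟨c, hc, hmax⟩ := isCompact_Icc.exists_isMaxOn (nonempty_Icc.2 h12.le)
    ((h.cg_Icc (v := r2) hr1.le).pow 2)
  have hzpos : 0 < g z ^ 2 := by have := hz.2; positivity
  have hcpos : 0 < g c ^ 2 := hzpos.trans_le (hmax (Ioo_subset_Icc_self hz.1))
  have hcne : g c ≠ 0 := fun h0 => by rw [h0] at hcpos; norm_num at hcpos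
  have hc' : c ∈ Ioo r1 r2 := by
    refine ⟨lt_of_le_of_ne hc.1 fun e => hcne (e ▸ hg1), lt_of_le_of_ne hc.2 fun e => hcne (e ▸ hg2)⟩
  have hc0 : 0 < c := hr1.trans hc'.1
  have hd := ((hmax.isLocalMax (Icc_mem_nhds hc'.1 hc'.2))).hasDerivAt_eq_zero
    ((h.dg c hc0).fun_pow 2)
  have hfc : f c = 0 := by
    have hs := h.sq_lt c hc0.le
    simp only [Nat.cast_ofNat, mul_eq_zero] at hd
    rcases hd with hd | hd | hd
    · rcases hd with hd | hd
      · norm_num at hd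
      · exact absurd (by simpa using hd) hcne
    · exact hd
    · linarith
  have e1 := two_mul_le_of_Ham_nonneg hfc hcne (hH2.trans (h.Ham_le hφ hc0.le hc'.2.le))
  have e2 := hlt c ⟨h1.trans hc'.1.le, hc'.2.le⟩
  linarith

end IsTraj

/-- If `y` and `y'` both converge at infinity, the limit of `y'` is zero. -/
theorem limit_deriv_eq_zero {y y' : ℝ → ℝ} {R c l : ℝ} (hd : ∀ r, R < r → HasDerivAt y (y' r) r)
    (hy : Tendsto y atTop (𝓝 c)) (hy' : Tendsto y' atTop (𝓝 l)) : l = 0 := by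
  have hmv : ∀ r, R < r → ∃ ξ, r < ξ ∧ y' ξ = y (r + 1) - y r := by
    intro r hr
    obtain ⟨ξ, hξ, he⟩ := exists_hasDerivAt_eq_slope y y' (lt_add_one r)
      (fun t ht => (hd t (hr.trans_le ht.1)).continuousAt.continuousWithinAt)
      (fun t ht => hd t (hr.trans ht.1))
    exact ⟨ξ, hξ.1, by rw [he]; simp⟩
  choose! ξ hξ hξ' using hmv
  have h1 : Tendsto ξ atTop atTop := by
    refine tendsto_atTop_mono' atTop ?_ tendsto_id
    filter_upwards [eventually_gt_atTop R] with r hr using (hξ r hr).le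
  have h2 : Tendsto (fun r => y (r + 1) - y r) atTop (𝓝 (c - c)) :=
    (hy.comp (tendsto_atTop_add_const_right _ 1 tendsto_id)).sub hy
  have h3 : Tendsto (fun r => y (r + 1) - y r) atTop (𝓝 l) := by
    refine (hy'.comp h1).congr' ?_
    filter_upwards [eventually_gt_atTop R] with r hr using hξ' r hr
  rw [tendsto_nhds_unique h3 h2, sub_self]

/-- A function monotone and bounded on `[R, ∞)` converges. -/
theorem exists_tendsto_of_monotoneOn {y : ℝ → ℝ} {R M : ℝ}
    (hm : ∀ u v, R ≤ u → u ≤ v → y u ≤ y v) (hM : ∀ r, R ≤ r → y r ≤ M) :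
    ∃ l, Tendsto y atTop (𝓝 l) := by
  have hmono : Monotone fun r => y (max r R) := fun u v huv =>
    hm _ _ (le_max_right _ _) (max_le_max_right R huv)
  have hb : BddAbove (range fun r => y (max r R)) := by
    refine ⟨M, ?_⟩
    rintro _ ⟨r, rfl⟩
    exact hM _ (le_max_right _ _)
  refine ⟨_, (tendsto_atTop_ciSup hmono hb).congr' ?_⟩
  filter_upwards [eventually_ge_atTop R] with r hr
  simp [max_eq_left hr]

theorem exists_tendsto_of_antitoneOn {y : ℝ → ℝ} {R M : ℝ}
    (hm : ∀ u v, R ≤ u → u ≤ v → y v ≤ y u) (hM : ∀ r, R ≤ r → M ≤ y r) :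
    ∃ l, Tendsto y atTop (𝓝 l) := by
  obtain ⟨l, hl⟩ := exists_tendsto_of_monotoneOn (y := fun r => -y r) (M := -M)
    (fun u v hu huv => neg_le_neg (hm u v hu huv)) (fun r hr => neg_le_neg (hM r hr))
  exact ⟨-l, by simpa using hl.neg⟩

namespace IsTraj

variable {a b : ℝ} {φ : ℝ → ℝ → ℝ} {f g : ℝ → ℝ}

theorem neg_le_Ham {f g : ℝ} (ha : 0 < a) (hb : 0 < b) (hg : g ^ 2 < 1) :
    -(b / 2) ≤ Ham a b f g := by
  unfold Ham
  have h1 : 0 ≤ f ^ 2 * (1 - g ^ 2) := mul_nonneg (sq_nonneg _) (by linarith)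
  have h2 : 0 ≤ a * g ^ 4 := by positivity
  nlinarith

theorem exists_tendsto_Ham (ha : 0 < a) (hb : 0 < b) (hφ : IsDamping a φ)
    (h : IsTraj a b φ f g) :
    ∃ L, Tendsto (fun r => Ham a b (f r) (g r)) atTop (𝓝 L) :=
  exists_tendsto_of_antitoneOn (R := 0) (fun _ _ hu huv => h.Ham_le hφ hu huv)
    (fun r hr => neg_le_Ham ha hb (h.sq_lt r hr))

theorem exists_limit_neg_iff (ha : 0 < a) (hb : 0 < b) (hφ : IsDamping a φ)
    (h : IsTraj a b φ f g) :
    (∃ L, L < 0 ∧ Tendsto (fun r => Ham a b (f r) (g r)) atTop (𝓝 L)) ↔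
      ∃ r, 0 < r ∧ Ham a b (f r) (g r) < 0 := by
  constructor
  · rintro ⟨L, hL, hlim⟩
    obtain ⟨r, hr⟩ := ((hlim.eventually_lt_const hL).and (eventually_gt_atTop 0)).exists
    exact ⟨r, hr.2, hr.1⟩
  · rintro ⟨r, hr0, hr⟩
    obtain ⟨L, hL⟩ := h.exists_tendsto_Ham ha hb hφ
    refine ⟨L, lt_of_le_of_lt ?_ hr, hL⟩
    refine le_of_tendsto hL ?_
    filter_upwards [eventually_ge_atTop r] with t ht using h.Ham_le hφ hr0.le ht

/-- Zeros of `g` are simple, hence the sign changes are exactly the zeros. -/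
theorem setOf_changesSignAt (h : IsTraj a b φ f g) :
    {r | ChangesSignAt g (Ioi 0) r} = {r | 0 < r ∧ g r = 0} := by
  ext r
  constructor
  · rintro ⟨hg, ε, hε, hsub, -⟩
    exact ⟨hsub ⟨by linarith, by linarith⟩, hg⟩
  · rintro ⟨hr, hg⟩
    refine ⟨hg, ?_⟩
    have hder := h.dg r hr
    have hev : ∀ᶠ ε in 𝓝[>] (0 : ℝ), g (r - ε) * g (r + ε) < 0 := by
      have hs := hasDerivAt_iff_tendsto_slope.1 hder
      have hne := h.ne_zero r hr hg
      have e : f r * (1 - g r ^ 2) = f r := by rw [hg]; ring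
      rw [e] at hs
      have t1 : Tendsto (fun ε : ℝ => r + ε) (𝓝[>] 0) (𝓝[≠] r) := by
        refine tendsto_nhdsWithin_iff.2 ⟨?_, ?_⟩
        · have : Tendsto (fun ε : ℝ => r + ε) (𝓝 0) (𝓝 (r + 0)) :=
            (continuous_const.add continuous_id).tendsto 0
          rw [add_zero] at this
          exact this.mono_left nhdsWithin_le_nhds
        · filter_upwards [self_mem_nhdsWithin] with ε hε
          have : (0 : ℝ) < ε := hε
          simp [this.ne']
      have t2 : Tendsto (fun ε : ℝ => r - ε) (𝓝[>] 0) (𝓝[≠] r) := by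
        refine tendsto_nhdsWithin_iff.2 ⟨?_, ?_⟩
        · have : Tendsto (fun ε : ℝ => r - ε) (𝓝 0) (𝓝 (r - 0)) :=
            (continuous_const.sub continuous_id).tendsto 0
          rw [sub_zero] at this
          exact this.mono_left nhdsWithin_le_nhds
        · filter_upwards [self_mem_nhdsWithin] with ε hε
          have : (0 : ℝ) < ε := hε
          simp [this.ne']
      have hm := (hs.comp t1).mul (hs.comp t2)
      have hpos : 0 < f r * f r := mul_self_pos.2 hne
      filter_upwards [hm.eventually_const_lt hpos, self_mem_nhdsWithin] with ε hε hε0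
      have hε0 : (0 : ℝ) < ε := hε0
      simp only [Function.comp_apply, slope_def_field, hg, sub_zero, add_sub_cancel_left,
        sub_sub_cancel_left] at hε
      have e2 : g (r + ε) / ε * (g (r - ε) / -ε) = -(g (r - ε) * g (r + ε)) / ε ^ 2 := by
        field_simp
      rw [e2] at hε
      have := pos_of_mul_pos_left (by rwa [div_eq_mul_inv] at hε) (by positivity)
      linarith
    obtain ⟨δ, hδ, hδ'⟩ := mem_nhdsGT_iff_exists_Ioo_subset.1 hev
    have hδ : (0 : ℝ) < δ := hδ
    refine ⟨min (δ / 2) (r / 2), by positivity, ?_, ?_, ?_⟩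
    · intro t ht
      have : min (δ / 2) (r / 2) ≤ r / 2 := min_le_right _ _
      have := ht.1
      show 0 < t
      linarith
    · exact hδ' ⟨by positivity, lt_of_le_of_lt (min_le_left _ _) (by linarith)⟩
    · intro t ht
      have h1 : t < δ / 2 := ht.2.trans_le (min_le_left _ _)
      exact le_of_lt (hδ' ⟨ht.1, by linarith⟩)

theorem changesSignExactly_iff (h : IsTraj a b φ f g) {k : ℕ} :
    ChangesSignExactly g (Ioi 0) k ↔
      {r | 0 < r ∧ g r = 0}.Finite ∧ {r | 0 < r ∧ g r = 0}.ncard = k := by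
  unfold ChangesSignExactly
  rw [h.setOf_changesSignAt]

theorem tendsto_zero_of_pos (hb : 0 < b) (hab : 2 * b < a) (hφ : IsDamping a φ)
    (h : IsTraj a b φ f g) {R : ℝ} (hR : 0 < R) (hg : ∀ r, R ≤ r → 0 < g r)
    (hH : ∀ r, 0 < r → 0 ≤ Ham a b (f r) (g r)) :
    Tendsto (fun r => (f r, g r)) atTop (𝓝 ((0 : ℝ), (0 : ℝ))) := by
  have ha : 0 < a := by linarith
  -- `f` has eventually a constant sign
  obtain ⟨S, hS, hsign⟩ : ∃ S, R ≤ S ∧ ((∀ r, S ≤ r → 0 ≤ f r) ∨ ∀ r, S ≤ r → f r ≤ 0) := by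
    by_cases hpos : ∀ r, R ≤ r → 0 ≤ f r
    · exact ⟨R, le_rfl, Or.inl hpos⟩
    · push Not at hpos
      obtain ⟨S, hS, hfS⟩ := hpos
      refine ⟨S, hS, Or.inr fun r hr => ?_⟩
      exact h.f_nonpos hb (hR.trans_le hS) (fun t ht => (hg t (hS.trans ht.1)).le)
        (fun t ht => hH t (hR.trans_le (hS.trans ht.1))) hfS.le r ⟨hr, le_rfl⟩
  have hS0 : 0 < S := hR.trans_le hS
  have hfac : ∀ r, 0 < r → 0 < 1 - g r ^ 2 := fun r hr => by linarith [h.sq_lt r hr.le]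
  -- hence `g` converges
  obtain ⟨γ, hγ⟩ : ∃ γ, Tendsto g atTop (𝓝 γ) := by
    rcases hsign with hs | hs
    · refine exists_tendsto_of_monotoneOn (R := S) (M := 1) (fun u v hu huv => ?_) (fun r hr => ?_)
      · exact le_of_hasDerivAt_nonneg huv (h.cg_Icc (hS0.le.trans hu))
          (fun t ht => h.dg t (hS0.trans_le (hu.trans ht.1.le)))
          (fun t ht => mul_nonneg (hs t (hu.trans ht.1.le))
            (hfac t (hS0.trans_le (hu.trans ht.1.le))).le)
      · exact (abs_lt.1 (h.abs_g_lt (hS0.le.trans hr))).2.le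
    · refine exists_tendsto_of_antitoneOn (R := S) (M := 0) (fun u v hu huv => ?_) (fun r hr => ?_)
      · exact le_of_hasDerivAt_nonpos huv (h.cg_Icc (hS0.le.trans hu))
          (fun t ht => h.dg t (hS0.trans_le (hu.trans ht.1.le)))
          (fun t ht => mul_nonpos_of_nonpos_of_nonneg (hs t (hu.trans ht.1.le))
            (hfac t (hS0.trans_le (hu.trans ht.1.le))).le)
      · exact (hg r (hS.trans hr)).le
  obtain ⟨L, hL⟩ := h.exists_tendsto_Ham ha hb hφ
  have hL0 : 0 ≤ L := ge_of_tendsto hL (by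
    filter_upwards [eventually_gt_atTop 0] with r hr using hH r hr)
  have hLlt : L < (a - 2 * b) / 4 := by
    refine lt_of_le_of_lt (le_of_tendsto hL ?_) (h.ham_lt S hS0.le)
    filter_upwards [eventually_ge_atTop S] with t ht using h.Ham_le hφ hS0.le ht
  have hγ0 : 0 ≤ γ := ge_of_tendsto hγ (by
    filter_upwards [eventually_ge_atTop R] with r hr using (hg r hr).le)
  have hγ1 : γ ^ 2 ≤ 1 := le_of_tendsto (hγ.pow 2) (by
    filter_upwards [eventually_ge_atTop 0] with r hr using (h.sq_lt r hr).le)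
  have hγlt : γ ^ 2 < 1 := by
    refine lt_of_le_of_ne hγ1 fun he => ?_
    have h0 : Tendsto (fun r => (1 - g r ^ 2) * (a - b)) atTop (𝓝 ((1 - γ ^ 2) * (a - b))) :=
      ((hγ.pow 2).const_sub 1).mul_const _
    have h1 : Tendsto (fun r => (a - 2 * b) / 4 - Ham a b (f r) (g r)) atTop
        (𝓝 ((a - 2 * b) / 4 - L)) := hL.const_sub _
    have := le_of_tendsto_of_tendsto h1 h0 (by
      filter_upwards [eventually_gt_atTop 0] with r hr
      rw [Ham_eq]
      have e1 := hfac r hr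
      have e2 : a * g r ^ 2 + (a - 2 * b) - 2 * f r ^ 2 ≤ 4 * (a - b) := by
        nlinarith [h.sq_lt r hr.le, sq_nonneg (f r)]
      have := mul_le_mul_of_nonneg_left e2 e1.le
      linarith)
    rw [he] at this
    linarith
  -- `f²`, hence `f`, converges
  have hden : 1 - γ ^ 2 ≠ 0 := by linarith
  have hf2 : ∃ c, Tendsto (fun r => f r ^ 2) atTop (𝓝 c) := by
    refine ⟨_, (((hL.sub ((hγ.pow 4).const_mul (a / 4))).add ((hγ.pow 2).const_mul (b / 2))).div
      ((hγ.pow 2).const_sub 1) hden |>.const_mul 2).congr' ?_⟩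
    filter_upwards [eventually_gt_atTop 0] with r hr
    have := (hfac r hr).ne'
    unfold Ham
    simp only [Pi.div_apply]
    field_simp
    ring
  obtain ⟨c, hc⟩ := hf2
  obtain ⟨β, hβ⟩ : ∃ β, Tendsto f atTop (𝓝 β) := by
    have hsq : Tendsto (fun r => Real.sqrt (f r ^ 2)) atTop (𝓝 (Real.sqrt c)) := hc.sqrt
    rcases hsign with hs | hs
    · refine ⟨_, hsq.congr' ?_⟩
      filter_upwards [eventually_ge_atTop S] with r hr
      rw [Real.sqrt_sq (hs r hr)]
    · refine ⟨_, hsq.neg.congr' ?_⟩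
      filter_upwards [eventually_ge_atTop S] with r hr
      rw [Real.sqrt_sq_eq_abs, abs_of_nonpos (hs r hr), neg_neg]
  have hβ0 : β = 0 := by
    have := limit_deriv_eq_zero (R := 0) h.dg hγ (hβ.mul ((hγ.pow 2).const_sub 1))
    exact (mul_eq_zero.1 this).resolve_right hden
  rw [hβ0] at hβ
  have hdamp : Tendsto (fun r => 2 * φ (f r) (g r) / r * f r) atTop (𝓝 0) := by
    have hz : Tendsto (fun r => 2 * |f r|) atTop (𝓝 0) := by
      simpa using hβ.abs.const_mul 2
    refine squeeze_zero_norm' ?_ hz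
    filter_upwards [eventually_ge_atTop 1] with r hr
    rw [Real.norm_eq_abs, abs_mul]
    refine mul_le_mul_of_nonneg_right ?_ (abs_nonneg _)
    have h1 := hφ.nonneg (f r) (g r)
    have h2 := hφ.le_one (f r) (g r)
    rw [abs_of_nonneg (by positivity), div_le_iff₀ (by linarith)]
    nlinarith
  have hstat := limit_deriv_eq_zero (R := 0) h.df hβ
    ((hγ.mul (((hβ.pow 2).sub ((hγ.pow 2).const_mul a)).add_const b)).sub hdamp)
  have hLeq : L = Ham a b 0 γ := by
    refine tendsto_nhds_unique hL ?_
    unfold Ham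
    exact ((((hβ.pow 2).const_mul (1 / 2)).mul ((hγ.pow 2).const_sub 1)).add
      ((hγ.pow 4).const_mul (a / 4))).sub ((hγ.pow 2).const_mul (b / 2))
  have hγz : γ = 0 := by
    by_contra hne
    have h2 := two_mul_le_of_Ham_nonneg rfl hne (hLeq ▸ hL0)
    have h3 : γ * (0 ^ 2 - a * γ ^ 2 + b) = 0 := by linarith
    have := (mul_eq_zero.1 h3).resolve_left hne
    linarith
  rw [hγz] at hγ
  exact hβ.prodMk_nhds hγ

theorem tendsto_zero_of_ne (hb : 0 < b) (hab : 2 * b < a) (hφ : IsDamping a φ)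
    (h : IsTraj a b φ f g) {R : ℝ} (hR : 0 < R) (hg : ∀ r, R ≤ r → g r ≠ 0)
    (hH : ∀ r, 0 < r → 0 ≤ Ham a b (f r) (g r)) :
    Tendsto (fun r => (f r, g r)) atTop (𝓝 ((0 : ℝ), (0 : ℝ))) := by
  have hsign : (∀ r, R ≤ r → 0 < g r) ∨ ∀ r, R ≤ r → g r < 0 := by
    by_contra! hcon
    obtain ⟨⟨r1, hr1, h1⟩, r2, hr2, h2⟩ := hcon
    obtain ⟨z, hz, hz0⟩ := isPreconnected_Ici.intermediate_value (mem_Ici.2 hr1) (mem_Ici.2 hr2)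
      (h.cg.mono (Ici_subset_Ici.2 hR.le)) ⟨h1, h2⟩
    exact hg z hz hz0
  rcases hsign with hs | hs
  · exact h.tendsto_zero_of_pos hb hab hφ hR hs hH
  · have := ((h.neg hφ).tendsto_zero_of_pos hb hab hφ hR (fun r hr => by linarith [hs r hr])
      (fun r hr => by rw [Ham_neg]; exact hH r hr)).neg
    simpa using this

theorem tendsto_Ham_zero (ht : Tendsto (fun r => (f r, g r)) atTop (𝓝 ((0 : ℝ), (0 : ℝ)))) :
    Tendsto (fun r => Ham a b (f r) (g r)) atTop (𝓝 0) := by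
  have hf := ht.fst_nhds
  have hg := ht.snd_nhds
  have := ((((hf.pow 2).const_mul (1 / 2)).mul ((hg.pow 2).const_sub 1)).add
      ((hg.pow 4).const_mul (a / 4))).sub ((hg.pow 2).const_mul (b / 2))
  unfold Ham
  simpa using this

/-- A Pohozaev-type estimate: trajectories tending to the origin have energy `o(1/r)`. -/
theorem tendsto_mul_Ham (hb : 0 < b) (hab : 2 * b < a) (hφ : IsDamping a φ)
    (h : IsTraj a b φ f g) (hH : ∀ r, 0 < r → 0 ≤ Ham a b (f r) (g r))
    (ht : Tendsto (fun r => (f r, g r)) atTop (𝓝 ((0 : ℝ), (0 : ℝ)))) :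
    Tendsto (fun r => r * Ham a b (f r) (g r)) atTop (𝓝 0) := by
  have ha : 0 < a := by linarith
  have hg2 : Tendsto (fun r => a * g r ^ 2) atTop (𝓝 0) := by
    simpa using (ht.snd_nhds.pow 2).const_mul a
  obtain ⟨R, hR⟩ := eventually_atTop.1
    (((tendsto_Ham_zero (a := a) (b := b) ht).eventually_le_const (level_pos hb hab)).and
      ((hg2.eventually_le_const hb).and (eventually_gt_atTop 0)))
  have hR0 : 0 < R := (hR R le_rfl).2.2
  have key : ∀ r, R ≤ r → r ^ 2 * Ham a b (f r) (g r) ≤ R ^ 2 * Ham a b (f R) (g R) := by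
    intro r hr
    refine le_of_hasDerivAt_nonpos (p := fun r => r ^ 2 * Ham a b (f r) (g r)) hr
      ((continuousOn_id.pow 2).mul (continuousOn_Ham (h.cf_Icc hR0.le) (h.cg_Icc hR0.le)))
      (fun t ht => (hasDerivAt_pow 2 t).fun_mul (h.hasDerivAt_Ham (hR0.trans ht.1))) ?_
    intro t ht
    have ht0 : 0 < t := hR0.trans ht.1
    obtain ⟨h1, h2, -⟩ := hR t ht.1.le
    have hs := h.sq_lt t ht0.le
    rw [eq_one_of_Ham_le hφ hb hab rfl hs h1]
    unfold Ham
    set X := f t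
    set Y := g t
    have e : t ^ 2 * (-(2 * 1 / t) * (X ^ 2 * (1 - Y ^ 2))) = -(2 * t) * (X ^ 2 * (1 - Y ^ 2)) := by
      field_simp
    rw [e]
    have h3 : 0 ≤ X ^ 2 * (1 - Y ^ 2) := mul_nonneg (sq_nonneg _) (by linarith)
    have h4 : 0 ≤ Y ^ 2 * (b - a * Y ^ 2) := mul_nonneg (sq_nonneg _) (by linarith)
    have h5 : 0 ≤ Y ^ 2 * b := by positivity
    have : 0 ≤ t * (X ^ 2 * (1 - Y ^ 2) + Y ^ 2 * b - a / 2 * Y ^ 4) :=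
      mul_nonneg ht0.le (by linarith)
    simp only [Nat.cast_ofNat]
    norm_num
    linarith
  have hz : Tendsto (fun r => R ^ 2 * Ham a b (f R) (g R) / r) atTop (𝓝 0) :=
    tendsto_const_nhds.div_atTop tendsto_id
  refine squeeze_zero' ?_ ?_ hz
  · filter_upwards [eventually_gt_atTop 0] with r hr using mul_nonneg hr.le (hH r hr)
  · filter_upwards [eventually_ge_atTop R] with r hr
    have hr0 : 0 < r := hR0.trans_le hr
    rw [le_div_iff₀ hr0]
    linarith [key r hr]

/-- Trajectories starting close to `(0, 1)` have many zeros before reaching negative energy. -/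
theorem exists_bound (hb : 0 < b) (hab : 2 * b < a) (hφ : IsDamping a φ) (k : ℕ) :
    ∃ x₀ < 1, ∀ f g : ℝ → ℝ, IsTraj a b φ f g → (∃ r, 0 < r ∧ Ham a b (f r) (g r) < 0) →
      {r | 0 < r ∧ g r = 0}.Finite → {r | 0 < r ∧ g r = 0}.ncard = k → g 0 ≤ x₀ := by
  have ha : 0 < a := by linarith
  set C := Real.sqrt (a - b) with hC
  have hC0 : 0 ≤ C := Real.sqrt_nonneg _
  set l := (a - 2 * b) / 4 with hl
  have hl0 : 0 < l := by rw [hl]; linarith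
  set T := 8 * C * (k + 1) / l + 1 with hT
  have hT0 : 0 < T := by positivity
  have hTl : (k + 1) * (4 * C / T) < l / 2 := by
    rw [← mul_div_assoc, div_lt_iff₀ hT0]
    have : l * T = 8 * C * (k + 1) + l := by rw [hT]; field_simp
    nlinarith
  have hab' : 0 < a - b := by linarith
  refine ⟨1 - l / (2 * (a - b) * Real.exp (2 * C * T)), ?_, ?_⟩
  · have : 0 < l / (2 * (a - b) * Real.exp (2 * C * T)) := by positivity
    linarith
  intro f g h hneg hfin hcard
  by_contra! hcon
  have hgT : (1 - g T) * Real.exp (-(2 * C) * T) ≤ (1 - g 0) * Real.exp (-(2 * C) * 0) := by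
    refine le_of_hasDerivAt_nonpos (p := fun t => (1 - g t) * Real.exp (-(2 * C) * t)) hT0.le
      ((continuousOn_const.sub (h.cg_Icc le_rfl)).mul (by fun_prop))
      (fun t ht => ((h.dg t ht.1).const_sub 1).fun_mul
        ((hasDerivAt_id t).const_mul (-(2 * C))).exp) ?_
    intro t ht
    have h1 := abs_lt.1 (h.abs_g_lt ht.1.le)
    have h2 := abs_le.1 (h.abs_f_le ha ht.1.le)
    have e : 0 ≤ Real.exp (-(2 * C) * t) * ((1 - g t) * (f t * (1 + g t) + 2 * C)) := by
      refine mul_nonneg (Real.exp_pos _).le (mul_nonneg (by linarith) ?_)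
      nlinarith
    simp only [id]
    linarith
  have hgT' : (1 - g T) * (a - b) < l / 2 := by
    have e1 : Real.exp (-(2 * C) * T) = (Real.exp (2 * C * T))⁻¹ := by
      rw [← Real.exp_neg]; ring_nf
    rw [mul_zero, Real.exp_zero, mul_one, e1, ← div_eq_mul_inv,
      div_le_iff₀ (Real.exp_pos _)] at hgT
    have h2 : 1 - g 0 < l / (2 * (a - b) * Real.exp (2 * C * T)) := by linarith
    rw [lt_div_iff₀ (by positivity)] at h2
    nlinarith
  have hHT : l / 2 < Ham a b (f T) (g T) := by
    rw [Ham_eq, ← hl]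
    have h1 := abs_lt.1 (h.abs_g_lt hT0.le)
    have h2 := h.sq_lt T hT0.le
    have e2 : a * g T ^ 2 + (a - 2 * b) - 2 * f T ^ 2 ≤ 2 * (a - b) := by
      nlinarith [sq_nonneg (f T)]
    have e3 : 0 ≤ 1 - g T ^ 2 := by linarith
    have e4 := mul_le_mul_of_nonneg_left e2 e3
    have e5 : 1 - g T ^ 2 ≤ 2 * (1 - g T) := by nlinarith
    have e6 := mul_le_mul_of_nonneg_right e5 (by linarith : 0 ≤ 2 * (a - b))
    linarith
  obtain ⟨r, hr0, hr⟩ := hneg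
  have hTr : T ≤ r := by
    by_contra! hlt
    have := h.Ham_le hφ hr0.le hlt.le
    linarith
  obtain ⟨v, hv, hv0⟩ := intermediate_value_Icc' hTr
    (continuousOn_Ham (a := a) (b := b) (h.cf_Icc hT0.le) (h.cg_Icc hT0.le))
    (show (0 : ℝ) ∈ Icc _ _ from ⟨hr.le, by linarith⟩)
  have hsub : {r | r ∈ Ioo T v ∧ g r = 0} ⊆ {r | 0 < r ∧ g r = 0} :=
    fun t ht => ⟨hT0.trans ht.1.1, ht.2⟩
  have hle := Set.ncard_le_ncard hsub hfin
  have := h.dissipation_le_ncard ha hb hφ hT0 _ le_rfl hv.1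
    (fun t ht => by
      have := h.Ham_le hφ (hT0.le.trans ht.1) ht.2
      simp only at hv0
      linarith) (hfin.subset hsub) rfl
  simp only at hv0
  rw [hv0] at this
  have hle' : (({r | r ∈ Ioo T v ∧ g r = 0}.ncard : ℝ)) ≤ k := by
    rw [hcard] at hle; exact_mod_cast hle
  have h4 : 0 ≤ 4 * C / T := by positivity
  nlinarith

end IsTraj

/-- A function with derivative at least `m` around `r` and `|q r| < m δ` has a zero `δ`-close
to `r`. -/
theorem exists_zero_of_le_deriv {q e : ℝ → ℝ} {r δ m : ℝ} (hδ : 0 < δ)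
    (hd : ∀ t ∈ Icc (r - δ) (r + δ), HasDerivAt q (e t) t)
    (he : ∀ t ∈ Icc (r - δ) (r + δ), m ≤ e t) (hq : |q r| < m * δ) :
    ∃ z ∈ Ioo (r - δ) (r + δ), q z = 0 := by
  have hc : ContinuousOn q (Icc (r - δ) (r + δ)) :=
    fun t ht => (hd t ht).continuousAt.continuousWithinAt
  obtain ⟨hq1, hq2⟩ := abs_lt.1 hq
  obtain ⟨ξ, hξ, h1⟩ := exists_hasDerivAt_eq_slope q e (by linarith : r < r + δ)
    (hc.mono (Icc_subset_Icc_left (by linarith)))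
    (fun t ht => hd t ⟨by linarith [ht.1], ht.2.le⟩)
  obtain ⟨ζ, hζ, h2⟩ := exists_hasDerivAt_eq_slope q e (by linarith : r - δ < r)
    (hc.mono (Icc_subset_Icc_right (by linarith)))
    (fun t ht => hd t ⟨ht.1.le, by linarith [ht.2]⟩)
  have e1 := he ξ ⟨by linarith [hξ.1], hξ.2.le⟩
  have e2 := he ζ ⟨hζ.1.le, by linarith [hζ.2]⟩
  rw [h1, le_div_iff₀ (by linarith)] at e1
  rw [h2, le_div_iff₀ (by linarith)] at e2
  exact intermediate_value_Ioo (by linarith) hc ⟨by linarith, by linarith⟩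

theorem exists_zero_of_abs_deriv {q e : ℝ → ℝ} {r δ m : ℝ} (hδ : 0 < δ)
    (hd : ∀ t ∈ Icc (r - δ) (r + δ), HasDerivAt q (e t) t)
    (he : (∀ t ∈ Icc (r - δ) (r + δ), m ≤ e t) ∨ ∀ t ∈ Icc (r - δ) (r + δ), e t ≤ -m)
    (hq : |q r| < m * δ) : ∃ z ∈ Ioo (r - δ) (r + δ), q z = 0 := by
  rcases he with he | he
  · exact exists_zero_of_le_deriv hδ hd he hq
  · obtain ⟨z, hz, h0⟩ := exists_zero_of_le_deriv (q := fun t => -q t) (e := fun t => -e t) hδ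
      (fun t ht => (hd t ht).fun_neg) (fun t ht => by linarith [he t ht]) (by rwa [abs_neg])
    exact ⟨z, hz, by linarith⟩

/-- A differentiable function has at most one zero on an interval where its derivative does not
vanish. -/
theorem zero_unique_of_deriv_ne {q e : ℝ → ℝ} {u v : ℝ}
    (hd : ∀ t ∈ Ioo u v, HasDerivAt q (e t) t) (he : ∀ t ∈ Ioo u v, e t ≠ 0)
    {z w : ℝ} (hz : z ∈ Ioo u v) (hw : w ∈ Ioo u v) (hqz : q z = 0) (hqw : q w = 0) : z = w := by
  by_contra hne
  wlog hlt : z < w generalizing z w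
  · exact this hw hz hqw hqz (Ne.symm hne) (lt_of_le_of_ne (not_lt.1 hlt) (Ne.symm hne))
  have hsub : Icc z w ⊆ Ioo u v := fun t ht => ⟨hz.1.trans_le ht.1, ht.2.trans_lt hw.2⟩
  obtain ⟨ξ, hξ, h0⟩ := exists_hasDerivAt_eq_zero hlt
    (fun t ht => (hd t (hsub ht)).continuousAt.continuousWithinAt) (hqz.trans hqw.symm)
    (fun t ht => hd t (hsub (Ioo_subset_Icc_self ht)))
  exact he ξ (hsub (Ioo_subset_Icc_self hξ)) h0

theorem finite_simple_zeros {p d : ℝ → ℝ} {R : ℝ} (cp : ContinuousOn p (Icc 0 R))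
    (hd : ∀ r ∈ Ioo 0 R, HasDerivAt p (d r) r) (h0 : p 0 ≠ 0) (hR : p R ≠ 0)
    (hs : ∀ r ∈ Ioo 0 R, p r = 0 → d r ≠ 0) : {r | r ∈ Ioo 0 R ∧ p r = 0}.Finite := by
  by_contra hinf
  obtain ⟨z, hz, hacc⟩ := Set.Infinite.exists_accPt_of_subset_isCompact hinf
    (isCompact_Icc (a := 0) (b := R)) (fun r hr => Ioo_subset_Icc_self hr.1)
  have hcl : IsClosed (Icc 0 R ∩ p ⁻¹' {0}) :=
    cp.preimage_isClosed_of_isClosed isClosed_Icc isClosed_singleton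
  have hzz : p z = 0 := by
    have h1 : z ∈ closure {r | r ∈ Ioo 0 R ∧ p r = 0} := mem_closure_iff_clusterPt.2 hacc.clusterPt
    have h2 : {r | r ∈ Ioo 0 R ∧ p r = 0} ⊆ Icc 0 R ∩ p ⁻¹' {0} :=
      fun r hr => ⟨Ioo_subset_Icc_self hr.1, hr.2⟩
    exact (closure_minimal h2 hcl h1).2
  have hz' : z ∈ Ioo 0 R :=
    ⟨lt_of_le_of_ne hz.1 fun e => h0 (e ▸ hzz), lt_of_le_of_ne hz.2 fun e => hR (e ▸ hzz)⟩
  have hev := (hd z hz').eventually_ne (c := 0) (hs z hz' hzz)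
  rw [accPt_iff_frequently_nhdsNE] at hacc
  obtain ⟨y, hy, hy'⟩ := (hacc.and_eventually hev).exists
  exact hy' hy.2

/-- The number of zeros of a function with simple zeros is stable under `C¹`-small
perturbations. -/
theorem exists_ncard_zeros_eq {p d : ℝ → ℝ} {R : ℝ} (hR : 0 < R)
    (cp : ContinuousOn p (Icc 0 R)) (cd : ContinuousOn d (Icc 0 R))
    (hd : ∀ r ∈ Ioo 0 R, HasDerivAt p (d r) r) (hp0 : p 0 ≠ 0) (hpR : p R ≠ 0)
    (hs : ∀ r ∈ Ioo 0 R, p r = 0 → d r ≠ 0) :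
    ∃ ε > 0, ∀ q e : ℝ → ℝ, (∀ r ∈ Ioo 0 R, HasDerivAt q (e r) r) →
      (∀ r ∈ Ioo 0 R, |q r - p r| < ε ∧ |e r - d r| < ε) →
      {r | r ∈ Ioo 0 R ∧ q r = 0}.Finite ∧
        {r | r ∈ Ioo 0 R ∧ q r = 0}.ncard = {r | r ∈ Ioo 0 R ∧ p r = 0}.ncard := by
  have hfin := finite_simple_zeros cp hd hp0 hpR hs
  obtain ⟨x, hx, hmin⟩ := isCompact_Icc.exists_isMinOn (nonempty_Icc.2 hR.le) (cp.abs.sup cd.abs)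
  obtain ⟨c, hc, hcmin⟩ : ∃ c > 0, ∀ r ∈ Icc 0 R, |p r| < 3 * c → 3 * c ≤ |d r| := by
    have hpos : 0 < max |p x| |d x| := by
      by_cases h0 : p x = 0
      · refine lt_max_of_lt_right (abs_pos.2 (hs x ⟨?_, ?_⟩ h0))
        · exact lt_of_le_of_ne hx.1 fun e => hp0 (e ▸ h0)
        · exact lt_of_le_of_ne hx.2 fun e => hpR (e ▸ h0)
      · exact lt_max_of_lt_left (abs_pos.2 h0)
    refine ⟨max |p x| |d x| / 3, by positivity, fun r hr hlt => ?_⟩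
    have h1 : max |p x| |d x| ≤ max |p r| |d r| := hmin hr
    rw [mul_div_cancel₀ _ (by norm_num : (3 : ℝ) ≠ 0)] at hlt ⊢
    exact (le_max_iff.1 h1).resolve_left (not_le.2 hlt)
  obtain ⟨δ₁, hδ₁, hu₁⟩ := Metric.uniformContinuousOn_iff.1
    (isCompact_Icc.uniformContinuousOn_of_continuous cd) c hc
  have hm : 0 < min |p 0| |p R| / 2 := by
    have := abs_pos.2 hp0
    have := abs_pos.2 hpR
    positivity
  obtain ⟨δ₂, hδ₂, hu₂⟩ := Metric.uniformContinuousOn_iff.1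
    (isCompact_Icc.uniformContinuousOn_of_continuous cp) _ hm
  set δ := min δ₁ δ₂ / 2 with hδ
  have hδ0 : 0 < δ := by positivity
  have hδ1 : δ < δ₁ := by have := min_le_left δ₁ δ₂; linarith
  have hδ2 : δ < δ₂ := by have := min_le_right δ₁ δ₂; linarith
  set ε := min (min c (c * δ)) (min |p 0| |p R| / 2) with hε
  have hε0 : 0 < ε := by positivity
  have hε1 : ε ≤ c := (min_le_left _ _).trans (min_le_left _ _)
  have hε2 : ε ≤ c * δ := (min_le_left _ _).trans (min_le_right _ _)
  have hε3 : ε ≤ min |p 0| |p R| / 2 := min_le_right _ _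
  have hloc : ∀ r ∈ Ioo 0 R, |p r| < ε → Icc (r - δ) (r + δ) ⊆ Ioo 0 R ∧
      ((∀ t ∈ Icc (r - δ) (r + δ), 2 * c ≤ d t) ∨ ∀ t ∈ Icc (r - δ) (r + δ), d t ≤ -(2 * c)) := by
    intro r hr hpr
    have hr' := Ioo_subset_Icc_self hr
    have hsub : Icc (r - δ) (r + δ) ⊆ Ioo 0 R := by
      intro t ht
      constructor
      · by_contra! hcon
        have h1 := hu₂ r hr' 0 (left_mem_Icc.2 hR.le) (by
          rw [Real.dist_eq, sub_zero, abs_of_pos hr.1]; linarith [ht.1])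
        rw [Real.dist_eq] at h1
        have h2 := min_le_left |p 0| |p R|
        have h3 := abs_sub_abs_le_abs_sub (p 0) (p r)
        rw [abs_sub_comm] at h3
        linarith
      · by_contra! hcon
        have h1 := hu₂ r hr' R (right_mem_Icc.2 hR.le) (by
          rw [Real.dist_eq, abs_sub_comm, abs_of_pos (by linarith [hr.2])]; linarith [ht.2])
        rw [Real.dist_eq] at h1
        have h2 := min_le_right |p 0| |p R|
        have h3 := abs_sub_abs_le_abs_sub (p R) (p r)
        rw [abs_sub_comm] at h3
        linarith
    refine ⟨hsub, ?_⟩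
    have hclose : ∀ t ∈ Icc (r - δ) (r + δ), |d t - d r| < c := by
      intro t ht
      have := hu₁ t (Ioo_subset_Icc_self (hsub ht)) r hr' (by
        rw [Real.dist_eq]
        refine lt_of_le_of_lt (abs_le.2 ⟨?_, ?_⟩) hδ1 <;> linarith [ht.1, ht.2])
      rwa [Real.dist_eq] at this
    have h3 := hcmin r hr' (by linarith)
    rcases le_abs.1 h3 with h3 | h3
    · left
      intro t ht
      linarith [(abs_lt.1 (hclose t ht)).1]
    · right
      intro t ht
      linarith [(abs_lt.1 (hclose t ht)).2]
  refine ⟨ε, hε0, fun q e hq hclose => ?_⟩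
  have hloc' : ∀ r ∈ Ioo 0 R, |p r| < ε →
      ((∀ t ∈ Icc (r - δ) (r + δ), c ≤ e t) ∨ ∀ t ∈ Icc (r - δ) (r + δ), e t ≤ -c) := by
    intro r hr hpr
    obtain ⟨hsub, h⟩ := hloc r hr hpr
    refine h.imp (fun h t ht => ?_) (fun h t ht => ?_)
    · linarith [h t ht, (abs_lt.1 (hclose t (hsub ht)).2).1]
    · linarith [h t ht, (abs_lt.1 (hclose t (hsub ht)).2).2]
  have hne : ∀ {d' : ℝ → ℝ} {r m : ℝ}, 0 < m →
      ((∀ t ∈ Icc (r - δ) (r + δ), m ≤ d' t) ∨ ∀ t ∈ Icc (r - δ) (r + δ), d' t ≤ -m) →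
      ∀ t ∈ Ioo (r - δ) (r + δ), d' t ≠ 0 := by
    intro d' r m hm h t ht h0
    rcases h with h | h
    · linarith [h t (Ioo_subset_Icc_self ht)]
    · linarith [h t (Ioo_subset_Icc_self ht)]
  have hsmall : ∀ r ∈ Ioo 0 R, q r = 0 → |p r| < ε := by
    intro r hr h0
    have := (hclose r hr).1
    rwa [h0, zero_sub, abs_neg] at this
  have hex : ∀ r ∈ {r | r ∈ Ioo 0 R ∧ q r = 0}, ∃ z ∈ {r | r ∈ Ioo 0 R ∧ p r = 0},
      z ∈ Ioo (r - δ) (r + δ) := by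
    rintro r ⟨hr, h0⟩
    obtain ⟨hsub, h⟩ := hloc r hr (hsmall r hr h0)
    obtain ⟨z, hz, hz0⟩ := exists_zero_of_abs_deriv hδ0 (fun t ht => hd t (hsub ht)) h
      (by nlinarith [hsmall r hr h0, mul_pos hc hδ0])
    exact ⟨z, ⟨hsub (Ioo_subset_Icc_self hz), hz0⟩, hz⟩
  choose! ψ hψ hψ' using hex
  have hbij : BijOn ψ {r | r ∈ Ioo 0 R ∧ q r = 0} {r | r ∈ Ioo 0 R ∧ p r = 0} := by
    refine ⟨hψ, ?_, ?_⟩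
    · intro r hr r' hr' heq
      obtain ⟨hz, hz0⟩ := hψ r hr
      have hp : |p (ψ r)| < ε := by rw [hz0, abs_zero]; exact hε0
      have h1 := hψ' r hr
      have h2 := hψ' r' hr'
      rw [← heq] at h2
      exact zero_unique_of_deriv_ne
        (fun t ht => hq t ((hloc _ hz hp).1 (Ioo_subset_Icc_self ht))) (hne hc (hloc' _ hz hp))
        ⟨by linarith [h1.2], by linarith [h1.1]⟩ ⟨by linarith [h2.2], by linarith [h2.1]⟩ hr.2 hr'.2
    · rintro z ⟨hz, hz0⟩
      have hp : |p z| < ε := by rw [hz0, abs_zero]; exact hε0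
      obtain ⟨hsub, -⟩ := hloc z hz hp
      have hqz : |q z| < c * δ := by
        have := (hclose z hz).1
        rw [hz0, sub_zero] at this
        linarith
      obtain ⟨r, hr, hr0⟩ := exists_zero_of_abs_deriv hδ0 (fun t ht => hq t (hsub ht))
        (hloc' z hz hp) hqz
      have hrm : r ∈ {r | r ∈ Ioo 0 R ∧ q r = 0} := ⟨hsub (Ioo_subset_Icc_self hr), hr0⟩
      obtain ⟨hsub', h⟩ := hloc r hrm.1 (hsmall r hrm.1 hr0)
      refine ⟨r, hrm, zero_unique_of_deriv_ne (fun t ht => hd t (hsub' (Ioo_subset_Icc_self ht)))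
        (hne (by linarith) h) (hψ' r hrm) ⟨by linarith [hr.2], by linarith [hr.1]⟩
        (hψ r hrm).2 hz0⟩
  exact ⟨Set.Finite.of_finite_image (hfin.subset hbij.image_eq.le) hbij.injOn, hbij.ncard_eq⟩

theorem le_mul_exp_of_hasDerivAt_le {E E' : ℝ → ℝ} {K R : ℝ} (hR : 0 ≤ R)
    (hc : ContinuousOn E (Icc 0 R)) (hd : ∀ r ∈ Ioo 0 R, HasDerivAt E (E' r) r)
    (hE : ∀ r ∈ Ioo 0 R, E' r ≤ K * E r) : E R ≤ E 0 * Real.exp (K * R) := by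
  have := le_of_hasDerivAt_nonpos (p := fun t => E t * Real.exp (-K * t)) hR
    (hc.mul (by fun_prop)) (fun t ht => (hd t ht).fun_mul
        ((hasDerivAt_id t).const_mul (-K)).exp) (fun t ht => by
      have : Real.exp (-K * t) * (E' t - K * E t) ≤ 0 :=
        mul_nonpos_of_nonneg_of_nonpos (Real.exp_pos _).le (by linarith [hE t ht])
      simp only [id]
      linarith)
  rw [mul_zero, Real.exp_zero, mul_one, neg_mul, Real.exp_neg, ← div_eq_mul_inv,
    div_le_iff₀ (Real.exp_pos _)] at this
  exact this

theorem IsTraj.f_sq_le {a b : ℝ} {φ : ℝ → ℝ → ℝ} {f g : ℝ → ℝ} (hb : 0 < b) (hab : 2 * b < a)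
    (hφ : IsDamping a φ) (h : IsTraj a b φ f g) (hf0 : f 0 = 0) {r : ℝ} (hr : 0 ≤ r) :
    f r ^ 2 ≤ 2 * a * Real.sqrt (a - b) * r := by
  have ha : 0 < a := by linarith
  have := le_of_hasDerivAt_nonpos (p := fun t => f t ^ 2 - 2 * a * Real.sqrt (a - b) * t) hr
    (((h.cf_Icc le_rfl).pow 2).sub (by fun_prop))
    (fun t ht => ((h.df t ht.1).fun_pow 2).fun_sub
      ((hasDerivAt_id t).const_mul (2 * a * Real.sqrt (a - b)))) ?_
  · simp only [hf0] at this
    linarith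
  intro t ht
  have h1 := h.abs_f_le ha ht.1.le
  have h2 := (h.abs_g_lt ht.1.le).le
  have h3 := h.f_sq_lt ha ht.1.le
  have h4 := h.sq_lt t ht.1.le
  have h5 : |f t ^ 2 - a * g t ^ 2 + b| ≤ a := by
    rw [abs_le]; constructor <;> nlinarith [sq_nonneg (f t), sq_nonneg (g t)]
  have h6 : |f t * g t * (f t ^ 2 - a * g t ^ 2 + b)| ≤ Real.sqrt (a - b) * 1 * a := by
    rw [abs_mul, abs_mul]
    gcongr
  have h7 := (abs_le.1 h6).2
  have h8 : 0 ≤ 2 * φ (f t) (g t) / t * f t ^ 2 :=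
    mul_nonneg (div_nonneg (mul_nonneg zero_le_two (hφ.nonneg _ _)) ht.1.le) (sq_nonneg _)
  simp only [Nat.cast_ofNat]
  norm_num
  linarith

/-- Pointwise bound on the nonlinearity differences. -/
theorem abs_nonlin_sub_le {a b C f₁ g₁ f₂ g₂ : ℝ} (hb : 0 < b) (ha : 0 < a)
    (hC : C ^ 2 = a - b) (h1 : |f₁| ≤ C) (h2 : |f₂| ≤ C)
    (k1 : |g₁| ≤ 1) (k2 : |g₂| ≤ 1) :
    |g₁ * (f₁ ^ 2 - a * g₁ ^ 2 + b) - g₂ * (f₂ ^ 2 - a * g₂ ^ 2 + b)| ≤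
      2 * C * |f₁ - f₂| + 4 * a * |g₁ - g₂| := by
  have e : g₁ * (f₁ ^ 2 - a * g₁ ^ 2 + b) - g₂ * (f₂ ^ 2 - a * g₂ ^ 2 + b) =
      (g₂ * (f₁ + f₂)) * (f₁ - f₂) + (f₁ ^ 2 + b - a * (g₁ ^ 2 + g₁ * g₂ + g₂ ^ 2)) * (g₁ - g₂) := by
    ring
  rw [e]
  refine (abs_add_le _ _).trans ?_
  rw [abs_mul, abs_mul (f₁ ^ 2 + b - _)]
  have m1 : |g₂ * (f₁ + f₂)| ≤ 2 * C := by
    rw [abs_mul]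
    have := abs_add_le f₁ f₂
    calc |g₂| * |f₁ + f₂| ≤ 1 * (2 * C) := by gcongr; linarith
      _ = 2 * C := one_mul _
  have m2 : |f₁ ^ 2 + b - a * (g₁ ^ 2 + g₁ * g₂ + g₂ ^ 2)| ≤ 4 * a := by
    have q1 : f₁ ^ 2 ≤ C ^ 2 := sq_le_sq' (by linarith [(abs_le.1 h1).1]) (abs_le.1 h1).2
    have q2 : g₁ ^ 2 ≤ 1 := (sq_le_one_iff_abs_le_one _).2 k1
    have q3 : g₂ ^ 2 ≤ 1 := (sq_le_one_iff_abs_le_one _).2 k2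
    have q4 : g₁ ^ 2 + g₁ * g₂ + g₂ ^ 2 ≤ 3 := by nlinarith [sq_nonneg (g₁ - g₂)]
    have q5 : 0 ≤ g₁ ^ 2 + g₁ * g₂ + g₂ ^ 2 := by nlinarith [sq_nonneg (g₁ + g₂)]
    rw [abs_le]
    constructor <;> nlinarith [sq_nonneg f₁]
  gcongr

theorem abs_flux_sub_le {C f₁ g₁ f₂ g₂ : ℝ} (h2 : |f₂| ≤ C) (k1 : |g₁| ≤ 1) (k2 : |g₂| ≤ 1) :
    |f₁ * (1 - g₁ ^ 2) - f₂ * (1 - g₂ ^ 2)| ≤ |f₁ - f₂| + 2 * C * |g₁ - g₂| := by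
  have e : f₁ * (1 - g₁ ^ 2) - f₂ * (1 - g₂ ^ 2) =
      (1 - g₁ ^ 2) * (f₁ - f₂) + (-(f₂ * (g₁ + g₂))) * (g₁ - g₂) := by ring
  have hC : 0 ≤ C := (abs_nonneg _).trans h2
  rw [e]
  refine (abs_add_le _ _).trans ?_
  rw [abs_mul, abs_mul (-_), abs_neg, abs_mul]
  have q2 : g₁ ^ 2 ≤ 1 := (sq_le_one_iff_abs_le_one _).2 k1
  have m1 : |1 - g₁ ^ 2| ≤ 1 := by rw [abs_le]; constructor <;> nlinarith [sq_nonneg g₁]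
  have m2 : |f₂| * |g₁ + g₂| ≤ 2 * C := by
    have := abs_add_le g₁ g₂
    calc |f₂| * |g₁ + g₂| ≤ C * 2 := by gcongr; linarith
      _ = 2 * C := mul_comm _ _
  calc _ ≤ 1 * |f₁ - f₂| + 2 * C * |g₁ - g₂| := by gcongr
    _ = _ := by rw [one_mul]

theorem neg_le_mul_damping_sub {p₁ p₂ f₁ f₂ t r₀ C L v : ℝ} (hr₀ : 0 < r₀) (ht : r₀ ≤ t)
    (h0 : 0 ≤ p₁) (h1 : p₁ ≤ 1) (hf : |f₂| ≤ C)
    (hL : |p₁ - p₂| ≤ L * (|f₁ - f₂| + |v|)) :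
    -(2 / r₀ * (1 + C * L) * (|f₁ - f₂| + |v|) * |f₁ - f₂|) ≤
      (f₁ - f₂) * (2 * p₁ / t * f₁ - 2 * p₂ / t * f₂) := by
  have hC : 0 ≤ C := (abs_nonneg _).trans hf
  have ht0 : 0 < t := hr₀.trans_le ht
  have e1 : 2 * p₁ / t * f₁ - 2 * p₂ / t * f₂ =
      2 / t * (p₁ * (f₁ - f₂) + f₂ * (p₁ - p₂)) := by ring
  have q1 : |p₁ * (f₁ - f₂) + f₂ * (p₁ - p₂)| ≤ (1 + C * L) * (|f₁ - f₂| + |v|) := by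
    refine (abs_add_le _ _).trans ?_
    rw [abs_mul, abs_mul, abs_of_nonneg h0]
    have w1 : p₁ * |f₁ - f₂| ≤ 1 * (|f₁ - f₂| + |v|) := by
      gcongr
      linarith [abs_nonneg v]
    have w2 : |f₂| * |p₁ - p₂| ≤ C * (L * (|f₁ - f₂| + |v|)) := by gcongr
    linarith
  have q2 : |2 / t| ≤ 2 / r₀ := by
    rw [abs_of_pos (by positivity)]
    gcongr
  have q3 : |(f₁ - f₂) * (2 * p₁ / t * f₁ - 2 * p₂ / t * f₂)| ≤
      |f₁ - f₂| * (2 / r₀ * ((1 + C * L) * (|f₁ - f₂| + |v|))) := by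
    rw [e1, abs_mul, abs_mul (2 / t)]
    gcongr
  have q4 := (abs_le.1 q3).1
  linarith

theorem energy_estimate {u v n₁ n₂ D A B : ℝ} (hA : 0 ≤ A) (hB : 0 ≤ B)
    (h₁ : |n₁| ≤ A * (|u| + |v|)) (h₂ : |n₂| ≤ A * (|u| + |v|))
    (hD : -(B * (|u| + |v|) * |u|) ≤ u * D) :
    2 * u * (n₁ - D) + 2 * v * n₂ ≤ 4 * (A + B) * (u ^ 2 + v ^ 2) := by
  have hu2 : |u| ^ 2 = u ^ 2 := sq_abs u
  have hv2 : |v| ^ 2 = v ^ 2 := sq_abs v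
  have o1 : u * n₁ ≤ |u| * (A * (|u| + |v|)) := by
    refine (le_abs_self _).trans ?_
    rw [abs_mul]
    gcongr
  have o2 : v * n₂ ≤ |v| * (A * (|u| + |v|)) := by
    refine (le_abs_self _).trans ?_
    rw [abs_mul]
    gcongr
  have o3 : (|u| + |v|) * (|u| + |v|) ≤ 2 * (u ^ 2 + v ^ 2) := by
    nlinarith [sq_nonneg (|u| - |v|)]
  have o4 := mul_le_mul_of_nonneg_left o3 (by positivity : 0 ≤ A + B)
  have o5 : 0 ≤ B * (|u| + |v|) * |v| := by positivity
  linarith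

/-- Grönwall estimate for the dependence on the initial datum. -/
theorem exists_eventually_le_exp {a b η : ℝ} (hb : 0 < b) (hab : 2 * b < a)
    (hη : η ∈ Ioo 0 (Real.sqrt (a - b) - Real.sqrt (a / 2)))
    {φ : ℝ → ℝ → ℝ} (hφ : IsCutoff a b η φ) {F G : ℝ → ℝ → ℝ}
    (hFG : ∀ y ∈ Ioo (0 : ℝ) 1, IsRegSolOn a b φ y (F y) (G y) (Ici 0))
    {s : ℝ} (hs : s ∈ Ioo (0 : ℝ) 1) :
    ∃ K : ℝ, 0 ≤ K ∧ ∀ᶠ x in 𝓝 s, ∀ r, 0 ≤ r →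
      (F x r - F s r) ^ 2 + (G x r - G s r) ^ 2 ≤ (x - s) ^ 2 * Real.exp (K * r) := by
  have hD := hφ.isDamping hη
  have ha : 0 < a := by linarith
  have hT : ∀ x ∈ Ioo (0 : ℝ) 1, IsTraj a b φ (F x) (G x) :=
    fun x hx => (hFG x hx).isTraj hb hab hD hx
  set C := Real.sqrt (a - b) with hC
  have hC2 : C ^ 2 = a - b := Real.sq_sqrt (by linarith)
  have hC0 : 0 < C := Real.sqrt_pos.2 (by linarith)
  -- uniform distance to the critical energy level
  set m := ((a - 2 * b) / 4 - Ham a b 0 s) / 2 with hm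
  have hHs : Ham a b 0 s < (a - 2 * b) / 4 := by
    have := (hT s hs).ham_lt 0 le_rfl
    rwa [(hFG s hs).1, (hFG s hs).2.1] at this
  have hm0 : 0 < m := by rw [hm]; linarith
  have hev : ∀ᶠ x in 𝓝 s, Ham a b 0 x < (a - 2 * b) / 4 - m := by
    have hcont : Continuous fun x => Ham a b 0 x := by unfold Ham; fun_prop
    exact hcont.continuousAt.eventually_lt_const (by linarith)
  set M := Real.sqrt (a - b - 2 * m) with hM
  have hMC : M < C := Real.sqrt_lt_sqrt_iff_of_pos (by linarith) |>.2 (by linarith)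
  have hfM : ∀ x ∈ Ioo (0 : ℝ) 1, Ham a b 0 x < (a - 2 * b) / 4 - m →
      ∀ r, 0 ≤ r → |F x r| ≤ M := by
    intro x hx hHx r hr
    refine Real.abs_le_sqrt ?_
    have h1 := (hT x hx).Ham_le hD le_rfl hr
    rw [(hFG x hx).1, (hFG x hx).2.1] at h1
    have h2 := (hT x hx).sq_lt r hr
    rw [Ham_eq a b (F x r)] at h1
    have h3 : 4 * m < (1 - G x r ^ 2) * (a * G x r ^ 2 + (a - 2 * b) - 2 * F x r ^ 2) := by
      linarith
    have h4 := pos_of_mul_pos_right ((by positivity : (0 : ℝ) < 4 * m).trans h3) (by linarith)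
    nlinarith [sq_nonneg (G x r)]
  have hsub : Icc (-M) M ×ˢ Icc (-1 : ℝ) 1 ⊆ Ioo (-C) C ×ˢ (univ : Set ℝ) :=
    fun p hp => ⟨⟨by linarith [hp.1.1], hp.1.2.trans_lt hMC⟩, mem_univ _⟩
  obtain ⟨Λ, hΛ⟩ := (hφ.2.1.mono hsub).exists_lipschitzOnWith
    (by simp) ((convex_Icc _ _).prod (convex_Icc _ _)) (isCompact_Icc.prod isCompact_Icc)
  set r₀ : ℝ := 1 / (4 * C) with hr₀
  have hr₀0 : 0 < r₀ := by positivity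
  set A := 2 * C + 4 * a + 1 with hA
  set B := 2 / r₀ * (1 + C * Λ) with hB
  have hB0 : 0 ≤ B := by positivity
  set K := 4 * (A + B) with hK
  have hK0 : 0 ≤ K := by positivity
  refine ⟨K, hK0, ?_⟩
  filter_upwards [hev, isOpen_Ioo.mem_nhds hs] with x hHx hx r hr
  have h1 := hT x hx
  have h2 := hT s hs
  have := le_mul_exp_of_hasDerivAt_le (K := K)
    (E := fun r => (F x r - F s r) ^ 2 + (G x r - G s r) ^ 2) hr
    ((((h1.cf_Icc le_rfl).sub (h2.cf_Icc le_rfl)).pow 2).add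
      (((h1.cg_Icc le_rfl).sub (h2.cg_Icc le_rfl)).pow 2))
    (fun t ht => (((h1.df t ht.1).fun_sub (h2.df t ht.1)).fun_pow 2).fun_add
      (((h1.dg t ht.1).fun_sub (h2.dg t ht.1)).fun_pow 2)) ?_
  · refine this.trans_eq ?_
    simp only [(hFG x hx).1, (hFG x hx).2.1, (hFG s hs).1, (hFG s hs).2.1]
    ring
  intro t ht
  have ht0 : 0 < t := ht.1
  have fM1 := hfM x hx hHx t ht0.le
  have fM2 := hfM s hs (by linarith) t ht0.le
  have f1 : |F x t| ≤ C := fM1.trans hMC.le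
  have f2 : |F s t| ≤ C := fM2.trans hMC.le
  have g1 := (h1.abs_g_lt ht0.le).le
  have g2 := (h2.abs_g_lt ht0.le).le
  have n1 := abs_nonlin_sub_le hb ha hC2 f1 f2 g1 g2
  have n2 := abs_flux_sub_le (f₁ := F x t) f2 g1 g2
  have s1 := h1.f_sq_le hb hab hD (hFG x hx).1 ht0.le
  have s2 := h2.f_sq_le hb hab hD (hFG s hs).1 ht0.le
  have n3 : -(B * (|F x t - F s t| + |G x t - G s t|) * |F x t - F s t|) ≤
      (F x t - F s t) *
        (2 * φ (F x t) (G x t) / t * F x t - 2 * φ (F s t) (G s t) / t * F s t) := by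
    rcases le_or_gt t r₀ with htr | htr
    · have hsm : 2 * a * C * t ≤ a / 2 := by
        have : 2 * a * C * t ≤ 2 * a * C * r₀ := by gcongr
        refine this.trans_eq ?_
        rw [hr₀]; field_simp; norm_num
      rw [hD.eq_one _ _ (s1.trans hsm), hD.eq_one _ _ (s2.trans hsm)]
      have e1 : (F x t - F s t) * (2 * 1 / t * F x t - 2 * 1 / t * F s t) =
          2 / t * (F x t - F s t) ^ 2 := by ring
      rw [e1]
      have p1 : 0 ≤ 2 / t * (F x t - F s t) ^ 2 := by positivity
      have p2 : 0 ≤ B * (|F x t - F s t| + |G x t - G s t|) * |F x t - F s t| := by positivity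
      linarith
    · have hlip := hΛ.dist_le_mul (F x t, G x t)
        ⟨abs_le.1 fM1, abs_le.1 g1⟩ (F s t, G s t) ⟨abs_le.1 fM2, abs_le.1 g2⟩
      simp only [Prod.dist_eq, Real.dist_eq] at hlip
      have hlip' : |φ (F x t) (G x t) - φ (F s t) (G s t)| ≤
          Λ * (|F x t - F s t| + |G x t - G s t|) := by
        refine hlip.trans ?_
        gcongr
        exact max_le (by linarith [abs_nonneg (G x t - G s t)])
          (by linarith [abs_nonneg (F x t - F s t)])
      exact neg_le_mul_damping_sub hr₀0 htr.le (hD.nonneg _ _) (hD.le_one _ _) f2 hlip'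
  have o := energy_estimate (A := A) (B := B) (by positivity) hB0
    (n1.trans (by rw [hA]; nlinarith [abs_nonneg (F x t - F s t), abs_nonneg (G x t - G s t)]))
    (n2.trans (by rw [hA]; nlinarith [abs_nonneg (F x t - F s t), abs_nonneg (G x t - G s t)]))
    n3
  rw [hK]
  refine le_trans (le_of_eq ?_) o
  push_cast
  ring

/-- Continuous dependence on the initial datum, uniformly on `[0, R]`. -/
theorem eventually_close {a b η : ℝ} (hb : 0 < b) (hab : 2 * b < a)
    (hη : η ∈ Ioo 0 (Real.sqrt (a - b) - Real.sqrt (a / 2)))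
    {φ : ℝ → ℝ → ℝ} (hφ : IsCutoff a b η φ) {F G : ℝ → ℝ → ℝ}
    (hFG : ∀ y ∈ Ioo (0 : ℝ) 1, IsRegSolOn a b φ y (F y) (G y) (Ici 0))
    {s : ℝ} (hs : s ∈ Ioo (0 : ℝ) 1) (R : ℝ) {ε : ℝ} (hε : 0 < ε) :
    ∀ᶠ x in 𝓝 s, ∀ r ∈ Icc 0 R, |F x r - F s r| < ε ∧ |G x r - G s r| < ε := by
  obtain ⟨K, hK, hev⟩ := exists_eventually_le_exp hb hab hη hφ hFG hs
  have hlim : ∀ᶠ x in 𝓝 s, (x - s) ^ 2 * Real.exp (K * R) < ε ^ 2 := by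
    have hcont : Continuous fun x => (x - s) ^ 2 * Real.exp (K * R) := by fun_prop
    refine hcont.continuousAt.eventually_lt_const ?_
    beta_reduce
    rw [sub_self, zero_pow two_ne_zero, zero_mul]
    positivity
  filter_upwards [hev, hlim] with x hgron hlx r hr
  have h1 := hgron r hr.1
  have h2 : (x - s) ^ 2 * Real.exp (K * r) ≤ (x - s) ^ 2 * Real.exp (K * R) := by
    gcongr
    exact hr.2
  constructor
  · exact abs_lt_of_sq_lt_sq (by linarith [sq_nonneg (G x r - G s r)]) hε.le
  · exact abs_lt_of_sq_lt_sq (by linarith [sq_nonneg (F x r - F s r)]) hε.le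

section Family

variable {a b η : ℝ} {φ : ℝ → ℝ → ℝ} {F G : ℝ → ℝ → ℝ} {s : ℝ}

theorem tendsto_family (hb : 0 < b) (hab : 2 * b < a)
    (hη : η ∈ Ioo 0 (Real.sqrt (a - b) - Real.sqrt (a / 2))) (hφ : IsCutoff a b η φ)
    (hFG : ∀ y ∈ Ioo (0 : ℝ) 1, IsRegSolOn a b φ y (F y) (G y) (Ici 0))
    (hs : s ∈ Ioo (0 : ℝ) 1) {r : ℝ} (hr : 0 ≤ r) :
    Tendsto (fun x => F x r) (𝓝 s) (𝓝 (F s r)) ∧ Tendsto (fun x => G x r) (𝓝 s) (𝓝 (G s r)) := by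
  constructor
  · refine Metric.tendsto_nhds.2 fun ε hε => ?_
    filter_upwards [eventually_close hb hab hη hφ hFG hs r hε] with x hx
    exact (hx r (right_mem_Icc.2 hr)).1
  · refine Metric.tendsto_nhds.2 fun ε hε => ?_
    filter_upwards [eventually_close hb hab hη hφ hFG hs r hε] with x hx
    exact (hx r (right_mem_Icc.2 hr)).2

theorem tendsto_Ham_family (hb : 0 < b) (hab : 2 * b < a)
    (hη : η ∈ Ioo 0 (Real.sqrt (a - b) - Real.sqrt (a / 2))) (hφ : IsCutoff a b η φ)
    (hFG : ∀ y ∈ Ioo (0 : ℝ) 1, IsRegSolOn a b φ y (F y) (G y) (Ici 0))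
    (hs : s ∈ Ioo (0 : ℝ) 1) {r : ℝ} (hr : 0 ≤ r) :
    Tendsto (fun x => Ham a b (F x r) (G x r)) (𝓝 s) (𝓝 (Ham a b (F s r) (G s r))) := by
  obtain ⟨hf, hg⟩ := tendsto_family hb hab hη hφ hFG hs hr
  exact ((((hf.pow 2).const_mul (1 / 2)).mul ((hg.pow 2).const_sub 1)).add
    ((hg.pow 4).const_mul (a / 4))).sub ((hg.pow 2).const_mul (b / 2))

/-- The zeros of `G s` on a bounded interval are finitely many, and their number is stable under
perturbations of `s`. -/
theorem eventually_ncard_zeros (hb : 0 < b) (hab : 2 * b < a)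
    (hη : η ∈ Ioo 0 (Real.sqrt (a - b) - Real.sqrt (a / 2))) (hφ : IsCutoff a b η φ)
    (hFG : ∀ y ∈ Ioo (0 : ℝ) 1, IsRegSolOn a b φ y (F y) (G y) (Ici 0))
    (hs : s ∈ Ioo (0 : ℝ) 1) {R : ℝ} (hR : 0 < R) (hGR : G s R ≠ 0) :
    {r | r ∈ Ioo 0 R ∧ G s r = 0}.Finite ∧ ∀ᶠ x in 𝓝 s, {r | r ∈ Ioo 0 R ∧ G x r = 0}.Finite ∧
      {r | r ∈ Ioo 0 R ∧ G x r = 0}.ncard = {r | r ∈ Ioo 0 R ∧ G s r = 0}.ncard := by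
  have ha : 0 < a := by linarith
  have hT : ∀ x ∈ Ioo (0 : ℝ) 1, IsTraj a b φ (F x) (G x) :=
    fun x hx => (hFG x hx).isTraj hb hab (hφ.isDamping hη) hx
  have hTs := hT s hs
  have h0 : G s 0 ≠ 0 := by rw [(hFG s hs).2.1]; exact hs.1.ne'
  have cg : ContinuousOn (G s) (Icc 0 R) := hTs.cg_Icc le_rfl
  have cf : ContinuousOn (F s) (Icc 0 R) := hTs.cf_Icc le_rfl
  have hsimple : ∀ r ∈ Ioo 0 R, G s r = 0 → F s r * (1 - G s r ^ 2) ≠ 0 := by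
    intro r hr h
    rw [h]
    simpa using hTs.ne_zero r hr.1 h
  have hd : ∀ r ∈ Ioo 0 R, HasDerivAt (G s) (F s r * (1 - G s r ^ 2)) r :=
    fun r hr => hTs.dg r hr.1
  refine ⟨finite_simple_zeros cg hd h0 hGR hsimple, ?_⟩
  obtain ⟨ε, hε, hst⟩ := exists_ncard_zeros_eq hR cg (cf.mul (continuousOn_const.sub (cg.pow 2))) hd h0 hGR
    hsimple
  set C := Real.sqrt (a - b) with hC
  have hC0 : 0 ≤ C := Real.sqrt_nonneg _
  have hε' : 0 < ε / (1 + 2 * C) := by positivity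
  filter_upwards [eventually_close hb hab hη hφ hFG hs R hε', isOpen_Ioo.mem_nhds hs] with x hx hx1
  refine hst (G x) (fun r => F x r * (1 - G x r ^ 2)) (fun r hr => (hT x hx1).dg r hr.1)
    fun r hr => ?_
  obtain ⟨h1, h2⟩ := hx r (Ioo_subset_Icc_self hr)
  rw [lt_div_iff₀ (by positivity)] at h1 h2
  have h3 := abs_flux_sub_le (f₁ := F x r) (hTs.abs_f_le ha hr.1.le)
    ((hT x hx1).abs_g_lt hr.1.le).le (hTs.abs_g_lt hr.1.le).le
  have h4' : 0 ≤ 2 * C * |F x r - F s r| := by positivity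
  have h5' : 0 ≤ 2 * C * |G x r - G s r| := by positivity
  refine ⟨by linarith, h3.trans_lt ?_⟩
  have hε'' : ε / (1 + 2 * C) * (1 + 2 * C) = ε := by field_simp
  have h6 := (hx r (Ioo_subset_Icc_self hr))
  have h7 : |F x r - F s r| + 2 * C * |G x r - G s r| <
      ε / (1 + 2 * C) + 2 * C * (ε / (1 + 2 * C)) := by
    have := mul_le_mul_of_nonneg_left h6.2.le (by positivity : 0 ≤ 2 * C)
    linarith [h6.1]
  linarith

theorem mem_Aset_iff (hb : 0 < b) (hab : 2 * b < a) (hD : IsDamping a φ)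
    (hFG : ∀ y ∈ Ioo (0 : ℝ) 1, IsRegSolOn a b φ y (F y) (G y) (Ici 0)) {k : ℕ} {x : ℝ} :
    x ∈ Aset a b F G k ↔ x ∈ Ioo (0 : ℝ) 1 ∧ (∃ r, 0 < r ∧ Ham a b (F x r) (G x r) < 0) ∧
      {r | 0 < r ∧ G x r = 0}.Finite ∧ {r | 0 < r ∧ G x r = 0}.ncard = k := by
  refine and_congr_right fun hx => ?_
  have hT := (hFG x hx).isTraj hb hab hD hx
  rw [hT.exists_limit_neg_iff (by linarith) hb hD, hT.changesSignExactly_iff]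

theorem Ham_nonneg_of_eq_zero {f g : ℝ} (hg : g = 0) : 0 ≤ Ham a b f g := by
  simp only [Ham, hg]
  nlinarith [sq_nonneg f]

theorem IsTraj.setOf_zeros_eq {f g : ℝ → ℝ} (hD : IsDamping a φ) (h : IsTraj a b φ f g) {R : ℝ}
    (hR : 0 < R) (hH : Ham a b (f R) (g R) < 0) :
    {r | 0 < r ∧ g r = 0} = {r | r ∈ Ioo 0 R ∧ g r = 0} := by
  ext r
  refine ⟨fun hr => ⟨⟨hr.1, ?_⟩, hr.2⟩, fun hr => ⟨hr.1.1, hr.2⟩⟩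
  by_contra! hle
  have h1 := h.Ham_le hD hR.le hle
  have h2 : 0 ≤ Ham a b (f r) (g r) := Ham_nonneg_of_eq_zero hr.2
  linarith

/-- The sets `A_k` are locally constant where the energy becomes negative. -/
theorem eventually_mem_Aset_of_frequently (hb : 0 < b) (hab : 2 * b < a)
    (hη : η ∈ Ioo 0 (Real.sqrt (a - b) - Real.sqrt (a / 2))) (hφ : IsCutoff a b η φ)
    (hFG : ∀ y ∈ Ioo (0 : ℝ) 1, IsRegSolOn a b φ y (F y) (G y) (Ici 0))
    (hs : s ∈ Ioo (0 : ℝ) 1) {k : ℕ} (hfr : ∃ᶠ x in 𝓝 s, x ∈ Aset a b F G k) {R : ℝ}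
    (hR : 0 < R) (hH : Ham a b (F s R) (G s R) < 0) : ∀ᶠ x in 𝓝 s, x ∈ Aset a b F G k := by
  have hD := hφ.isDamping hη
  have hGR : G s R ≠ 0 := fun h => not_lt.2 (Ham_nonneg_of_eq_zero h) hH
  have hev : ∀ᶠ x in 𝓝 s, x ∈ Ioo (0 : ℝ) 1 ∧ Ham a b (F x R) (G x R) < 0 ∧
      {r | 0 < r ∧ G x r = 0}.Finite ∧
      {r | 0 < r ∧ G x r = 0}.ncard = {r | r ∈ Ioo 0 R ∧ G s r = 0}.ncard := by
    filter_upwards [(tendsto_Ham_family hb hab hη hφ hFG hs hR.le).eventually_lt_const hH,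
      (eventually_ncard_zeros hb hab hη hφ hFG hs hR hGR).2, isOpen_Ioo.mem_nhds hs]
      with x h1 h2 hx
    rw [((hFG x hx).isTraj hb hab hD hx).setOf_zeros_eq hD hR h1]
    exact ⟨hx, h1, h2⟩
  obtain ⟨y, hy, -, -, -, hy'⟩ := (hfr.and_eventually hev).exists
  have hk := ((mem_Aset_iff hb hab hD hFG).1 hy).2.2.2
  filter_upwards [hev] with x hx
  exact (mem_Aset_iff hb hab hD hFG).2 ⟨hx.1, ⟨R, hR, hx.2.1⟩, hx.2.2.1, by rw [hx.2.2.2, ← hy', hk]⟩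

/-- A limit point of `A_k` has finitely many zeros. -/
theorem finite_zeros_of_frequently (hb : 0 < b) (hab : 2 * b < a)
    (hη : η ∈ Ioo 0 (Real.sqrt (a - b) - Real.sqrt (a / 2))) (hφ : IsCutoff a b η φ)
    (hFG : ∀ y ∈ Ioo (0 : ℝ) 1, IsRegSolOn a b φ y (F y) (G y) (Ici 0))
    (hs : s ∈ Ioo (0 : ℝ) 1) {k : ℕ} (hfr : ∃ᶠ x in 𝓝 s, x ∈ Aset a b F G k) :
    {r | 0 < r ∧ G s r = 0}.Finite := by
  have hD := hφ.isDamping hη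
  have hTs := (hFG s hs).isTraj hb hab hD hs
  by_contra hinf
  obtain ⟨t, ht, htfin, htcard⟩ := Set.Infinite.exists_subset_ncard_eq hinf (k + 1)
  have htne : t.Nonempty := (Set.ncard_pos htfin).1 (by omega)
  obtain ⟨M, hM, hmax⟩ := htfin.exists_maximal htne
  have hM' := ht hM
  have hne := (hTs.dg M hM'.1).eventually_ne (c := 0) (by
    rw [hM'.2]; simpa using hTs.ne_zero M hM'.1 hM'.2)
  have hgt : ∀ᶠ r in 𝓝[>] M, G s r ≠ 0 := hne.filter_mono
    (nhdsWithin_mono _ fun x hx => (ne_of_gt hx : x ≠ M))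
  obtain ⟨R, hGR, hRM⟩ := (hgt.and self_mem_nhdsWithin).exists
  have hR : 0 < R := hM'.1.trans hRM
  obtain ⟨hfin, hev⟩ := eventually_ncard_zeros hb hab hη hφ hFG hs hR hGR
  obtain ⟨x, hx, -, hx2⟩ := (hfr.and_eventually hev).exists
  obtain ⟨-, -, hxfin, hxk⟩ := (mem_Aset_iff hb hab hD hFG).1 hx
  have h1 : {r | r ∈ Ioo 0 R ∧ G x r = 0}.ncard ≤ {r | 0 < r ∧ G x r = 0}.ncard :=
    Set.ncard_le_ncard (fun r hr => ⟨hr.1.1, hr.2⟩) hxfin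
  have h2 : t.ncard ≤ {r | r ∈ Ioo 0 R ∧ G s r = 0}.ncard := by
    refine Set.ncard_le_ncard (fun r hr => ⟨⟨(ht hr).1, ?_⟩, (ht hr).2⟩) hfin
    rcases le_total r M with h | h
    · exact h.trans_lt hRM
    · exact (hmax hr h).trans_lt hRM
  omega

/-- At a limit point of `A_k` where the energy stays nonnegative, the number of zeros is `k`
or `k - 1`. -/
theorem ncard_zeros_of_frequently (hb : 0 < b) (hab : 2 * b < a)
    (hη : η ∈ Ioo 0 (Real.sqrt (a - b) - Real.sqrt (a / 2))) (hφ : IsCutoff a b η φ)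
    (hFG : ∀ y ∈ Ioo (0 : ℝ) 1, IsRegSolOn a b φ y (F y) (G y) (Ici 0))
    (hs : s ∈ Ioo (0 : ℝ) 1) {k : ℕ} (hfr : ∃ᶠ x in 𝓝 s, x ∈ Aset a b F G k)
    (hH : ∀ r, 0 < r → 0 ≤ Ham a b (F s r) (G s r)) {R₀ : ℝ} (hR₀ : 0 < R₀)
    (hg : ∀ r, R₀ ≤ r → G s r ≠ 0)
    (ht : Tendsto (fun r => (F s r, G s r)) atTop (𝓝 ((0 : ℝ), (0 : ℝ)))) :
    {r | 0 < r ∧ G s r = 0}.ncard = k ∨ {r | 0 < r ∧ G s r = 0}.ncard + 1 = k := by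
  have ha : 0 < a := by linarith
  have hD := hφ.isDamping hη
  have hTs := (hFG s hs).isTraj hb hab hD hs
  have hpos : 0 < Real.sqrt b * Real.sqrt (b / a) ^ 3 / 3 := by positivity
  have hlim1 := (IsTraj.tendsto_Ham_zero (a := a) (b := b) ht).eventually_lt_const
    (IsTraj.level_pos hb hab)
  have hlim2 : Tendsto (fun r => r * Ham a b (F s r) (G s r) + Real.sqrt b * |G s r| ^ 3 / 3) atTop
      (𝓝 0) := by
    have h1 := hTs.tendsto_mul_Ham hb hab hD hH ht
    have h2 := (((ht.snd_nhds.abs).pow 3).const_mul (Real.sqrt b)).div_const 3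
    simpa using h1.add h2
  obtain ⟨R, ⟨hR1, hR2⟩, hRR⟩ := ((hlim1.and (hlim2.eventually_lt_const hpos)).and
    (eventually_ge_atTop R₀)).exists
  have hR : 0 < R := hR₀.trans_le hRR
  have hGR := hg R hRR
  obtain ⟨hfG, hgG⟩ := tendsto_family hb hab hη hφ hFG hs hR.le
  have hHG := tendsto_Ham_family hb hab hη hφ hFG hs hR.le
  have hcond := (hHG.const_mul R).add
    ((((hgG.abs).pow 3).const_mul (Real.sqrt b)).div_const 3)
  obtain ⟨x, hx, ⟨-, hx2⟩, hx3, hx4⟩ := (hfr.and_eventually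
    ((eventually_ncard_zeros hb hab hη hφ hFG hs hR hGR).2.and
      ((hHG.eventually_lt_const hR1).and (hcond.eventually_lt_const hR2)))).exists
  obtain ⟨hx0, -, hxfin, hxk⟩ := (mem_Aset_iff hb hab hD hFG).1 hx
  have hTx := (hFG x hx0).isTraj hb hab hD hx0
  have hZs : {r | 0 < r ∧ G s r = 0} = {r | r ∈ Ioo 0 R ∧ G s r = 0} := by
    ext r
    refine ⟨fun hr => ⟨⟨hr.1, ?_⟩, hr.2⟩, fun hr => ⟨hr.1.1, hr.2⟩⟩
    by_contra! hle
    exact hg r (hRR.trans hle) hr.2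
  have hsub : {r | R ≤ r ∧ G x r = 0}.Subsingleton := by
    intro r1 h1 r2 h2
    by_contra hne
    rcases lt_or_gt_of_ne hne with h | h
    · exact hTx.zero_unique_of_small hb hab hD hR hx3.le hx4 h1.1 h h1.2 h2.2
    · exact hTx.zero_unique_of_small hb hab hD hR hx3.le hx4 h2.1 h h2.2 h1.2
  have hun : {r | 0 < r ∧ G x r = 0} = {r | r ∈ Ioo 0 R ∧ G x r = 0} ∪ {r | R ≤ r ∧ G x r = 0} := by
    ext r
    simp only [mem_ofPred_eq, mem_union, mem_Ioo]
    constructor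
    · rintro ⟨h1, h2⟩
      rcases lt_or_ge r R with h | h
      · exact Or.inl ⟨⟨h1, h⟩, h2⟩
      · exact Or.inr ⟨h, h2⟩
    · rintro (h | h)
      · exact ⟨h.1.1, h.2⟩
      · exact ⟨hR.trans_le h.1, h.2⟩
  have hdisj : Disjoint {r | r ∈ Ioo 0 R ∧ G x r = 0} {r | R ≤ r ∧ G x r = 0} :=
    Set.disjoint_left.2 fun r h1 h2 => absurd h1.1.2 (not_lt.2 h2.1)
  have hcard := Set.ncard_union_eq hdisj (hxfin.subset (hun ▸ subset_union_left)) hsub.finite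
  rw [← hun, hxk, hx2, ← hZs] at hcard
  have := (Set.ncard_le_one hsub.finite).2 fun r hr r' hr' => hsub hr hr'
  omega

end Family

/-- Lemma 2.8 (iv): if `A_k ≠ ∅` then `sup A_k ∈ I_{k−1} ∪ I_k`
(with `I_{−1} = ∅` when `k = 0`). -/
theorem sup_Aset_mem (a b η : ℝ) (hb : 0 < b) (hab : 2 * b < a)
    (hη : η ∈ Ioo 0 (Real.sqrt (a - b) - Real.sqrt (a / 2)))
    (φ : ℝ → ℝ → ℝ) (hφ : IsCutoff a b η φ)
    (F G : ℝ → ℝ → ℝ)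
    (hFG : ∀ y ∈ Ioo (0 : ℝ) 1, IsRegSolOn a b φ y (F y) (G y) (Ici 0))
    (k : ℕ) (hne : (Aset a b F G k).Nonempty) :
    sSup (Aset a b F G k) ∈ Iset a b F G k ∨
      ∃ j : ℕ, k = j + 1 ∧ sSup (Aset a b F G k) ∈ Iset a b F G j := by
  have ha : 0 < a := by linarith
  have hD := hφ.isDamping hη
  obtain ⟨x₀, hx₀, hbd⟩ := IsTraj.exists_bound hb hab hD k
  have hle : ∀ x ∈ Aset a b F G k, x ≤ x₀ := by
    intro x hx
    obtain ⟨hx1, hx2, hx3, hx4⟩ := (mem_Aset_iff hb hab hD hFG).1 hx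
    have := hbd (F x) (G x) ((hFG x hx1).isTraj hb hab hD hx1) hx2 hx3 hx4
    rwa [(hFG x hx1).2.1] at this
  have hbdd : BddAbove (Aset a b F G k) := ⟨x₀, hle⟩
  have hlub := isLUB_csSup hne hbdd
  set s := sSup (Aset a b F G k)
  have hs : s ∈ Ioo (0 : ℝ) 1 := by
    obtain ⟨y, hy⟩ := hne
    exact ⟨hy.1.1.trans_le (hlub.1 hy), (hlub.2 hle).trans_lt hx₀⟩
  have hfr : ∃ᶠ x in 𝓝 s, x ∈ Aset a b F G k :=
    (hlub.frequently_mem hne).filter_mono nhdsWithin_le_nhds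
  have hTs := (hFG s hs).isTraj hb hab hD hs
  have hH : ∀ r, 0 < r → 0 ≤ Ham a b (F s r) (G s r) := by
    by_contra! hcon
    obtain ⟨R, hR, hneg⟩ := hcon
    have hev := eventually_mem_Aset_of_frequently hb hab hη hφ hFG hs hfr hR hneg
    obtain ⟨x, hx, hsx⟩ := ((hev.filter_mono nhdsWithin_le_nhds).and
      (self_mem_nhdsWithin : Ioi s ∈ 𝓝[>] s)).exists
    exact not_lt.2 (hlub.1 hx) hsx
  have hfin := finite_zeros_of_frequently hb hab hη hφ hFG hs hfr
  obtain ⟨M, hM⟩ := hfin.bddAbove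
  have hg : ∀ r, max M 0 + 1 ≤ r → G s r ≠ 0 := by
    intro r hr h0
    have h1 := le_max_left M 0
    have h2 := le_max_right M 0
    have h3 : r ≤ M := hM ⟨by linarith, h0⟩
    linarith
  have hR₀ : 0 < max M 0 + 1 := by positivity
  have ht := hTs.tendsto_zero_of_ne hb hab hD hR₀ hg hH
  rcases ncard_zeros_of_frequently hb hab hη hφ hFG hs hfr hH hR₀ hg ht with h | h
  · exact Or.inl ⟨hs, ht, hTs.changesSignExactly_iff.2 ⟨hfin, h⟩⟩
  · exact Or.inr ⟨_, h.symm, hs, ht, hTs.changesSignExactly_iff.2 ⟨hfin, rfl⟩⟩
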